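/- There is a universal constant c > 0 such that for an R-regular C^{1} simple curve γ tangentially attached to ℝ₊ with modulus of continuity ω of γ' satisfying ω(R) ≤ 1/5, the driving function W of η = √γ satisfies |W_t| ≤ c·ω(5t)·t^{1/2} for all t ≤ R/5. In particular, if γ ∈ C^{1,β} then |W_t| ≤ C·t^{β+1/2} for a constant C depending on ‖γ‖_{1,β}. -/

import Mathlib

open Set Filter Complex

/-- The open upper half-plane, as a subset of `ℂ`. -/
def UHP : Set ℂ := {z : ℂ | 0 < z.im}

/-- `g` is the (hydrodynamically normalized) mapping-out function of the
compact `ℍ`-hull `K`. -/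
def IsMappingOut (K : Set ℂ) (g : ℂ → ℂ) : Prop :=
  DifferentiableOn ℂ g (UHP \ K) ∧ Set.BijOn g (UHP \ K) UHP ∧
    Tendsto (fun z => g z - z)
      (comap (fun z : ℂ => ‖z‖) atTop ⊓ 𝓟 (UHP \ K)) (nhds 0)

/-- The hull `K` has half-plane capacity `a`. -/
def HasHCap (K : Set ℂ) (a : ℝ) : Prop :=
  ∃ g, IsMappingOut K g ∧
    Tendsto (fun z => z * (g z - z))
      (comap (fun z : ℂ => ‖z‖) atTop ⊓ 𝓟 (UHP \ K)) (nhds (a : ℂ))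

/-- The branch of the square root mapping `ℂ ∖ ℝ₊` into the upper half-plane. -/
noncomputable def sqrtH (z : ℂ) : ℂ := Complex.I * ((-z) ^ ((1:ℂ)/2))

open scoped Topology ComplexConjugate
open Bornology (cobounded)

theorem isOpen_UHP : IsOpen UHP := isOpen_lt continuous_const Complex.continuous_im

/-- **Maximum principle** for the real part of a holomorphic function: a superlevel set in an open
set is never compact unless it is empty. -/
theorem re_lt_of_isCompact_superlevel {U : Set ℂ} (hU : IsOpen U) {F : ℂ → ℂ}
    (hF : DifferentiableOn ℂ F U) {c : ℝ} (hE : IsCompact {z | z ∈ U ∧ c ≤ (F z).re}) :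
    ∀ z ∈ U, (F z).re < c := by
  by_contra! hne
  obtain ⟨z₀, hz₀U, hz₀⟩ := hne
  set E : Set ℂ := {z | z ∈ U ∧ c ≤ (F z).re}
  have hcont : ContinuousOn (fun z => (F z).re) E :=
    Complex.continuous_re.comp_continuousOn (hF.continuousOn.mono fun z hz => hz.1)
  obtain ⟨z₁, hz₁, hmax⟩ := hE.exists_isMaxOn ⟨z₀, hz₀U, hz₀⟩ hcont
  have hle : ∀ z ∈ U, (F z).re ≤ (F z₁).re := fun z hz => by
    by_cases h : c ≤ (F z).re
    · exact hmax ⟨hz, h⟩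
    · exact (not_le.1 h).le.trans hz₁.2
  let S : Set ℂ := E ∩ (fun z => (F z).re) ⁻¹' Ici (F z₁).re
  have hScl : IsClosed S := hcont.preimage_isClosed_of_isClosed hE.isClosed isClosed_Ici
  have hSop : IsOpen S := by
    rw [isOpen_iff_mem_nhds]
    intro z hz
    have hzU : U ∈ 𝓝 z := hU.mem_nhds hz.1.1
    have hd : ∀ᶠ y in 𝓝 z, DifferentiableAt ℂ (fun y => Complex.exp (F y)) y := by
      filter_upwards [hU.eventually_mem hz.1.1] with y hy
      exact (hF.differentiableAt (hU.mem_nhds hy)).cexp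
    have hl : IsLocalMax (norm ∘ fun y => Complex.exp (F y)) z := by
      filter_upwards [hzU] with y hy
      simpa [Complex.norm_exp] using (hle y hy).trans hz.2
    filter_upwards [hzU, Complex.norm_eventually_eq_of_isLocalMax hd hl] with y hy h
    have h' : (F y).re = (F z).re := by simpa [Complex.norm_exp] using h
    refine ⟨⟨hy, h' ▸ hz.1.2⟩, ?_⟩
    simpa [h'] using hz.2
  have hSne : S.Nonempty := ⟨z₁, hz₁, mem_preimage.2 (mem_Ici.2 le_rfl)⟩
  have : S = univ := IsClopen.eq_univ ⟨hScl, hSop⟩ hSne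
  exact noncompact_univ ℂ (this ▸ hE.of_isClosed_subset hScl inter_subset_left)

theorem norm_sub_sq_add_four_im_mul_im (a b : ℂ) :
    ‖a - b‖ ^ 2 + 4 * (a.im * b.im) = ‖a - conj b‖ ^ 2 := by
  rw [← Complex.normSq_eq_norm_sq, ← Complex.normSq_eq_norm_sq, Complex.normSq_apply,
    Complex.normSq_apply]
  simp
  ring

theorem sub_conj_ne_zero {a b : ℂ} (ha : 0 < a.im) (hb : 0 ≤ b.im) : a - conj b ≠ 0 := by
  intro h
  have := congrArg Complex.im h
  simp at this
  linarith

theorem schwarz_pick_of_pos {G : ℂ → ℂ} (hG : DifferentiableOn ℂ G UHP)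
    (hpos : ∀ z ∈ UHP, 0 < (G z).im) {w w₀ : ℂ} (hw : w ∈ UHP) (hw₀ : w₀ ∈ UHP) :
    w.im * w₀.im * ‖G w - conj (G w₀)‖ ^ 2 ≤
      (G w).im * (G w₀).im * ‖w - conj w₀‖ ^ 2 := by
  have hw' : 0 < w.im := hw
  have hw₀' : 0 < w₀.im := hw₀
  set c : ℂ → ℂ := fun ζ => (w₀ - conj w₀ * ζ) / (1 - ζ)
  have hne : ∀ ζ ∈ Metric.ball (0 : ℂ) 1, 1 - ζ ≠ 0 := by
    intro ζ hζ h
    rw [mem_ball_zero_iff, ← sub_eq_zero.1 h] at hζ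
    simp at hζ
  have hc : ∀ ζ ∈ Metric.ball (0 : ℂ) 1, c ζ ∈ UHP := by
    intro ζ hζ
    have h1 := hne ζ hζ
    have hn : 0 < Complex.normSq (1 - ζ) := Complex.normSq_pos.2 h1
    have hζ' : Complex.normSq ζ < 1 := by
      rw [Complex.normSq_eq_norm_sq]
      rw [mem_ball_zero_iff] at hζ
      nlinarith [norm_nonneg ζ]
    have : (c ζ).im = w₀.im * (1 - Complex.normSq ζ) / Complex.normSq (1 - ζ) := by
      simp only [c, Complex.div_im]
      rw [Complex.normSq_apply ζ]
      simp
      ring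
    change 0 < (c ζ).im
    rw [this]
    have : 0 < 1 - Complex.normSq ζ := by linarith
    positivity
  set φ : ℂ → ℂ := fun ζ => (G (c ζ) - G w₀) / (G (c ζ) - conj (G w₀))
  have hd : DifferentiableOn ℂ φ (Metric.ball 0 1) := by
    have hcd : DifferentiableOn ℂ c (Metric.ball 0 1) := by
      refine DifferentiableOn.div (by fun_prop) (by fun_prop) hne
    have hGc : DifferentiableOn ℂ (fun ζ => G (c ζ)) (Metric.ball 0 1) := hG.comp hcd hc
    refine DifferentiableOn.div (hGc.sub_const _) (hGc.sub_const _) fun ζ hζ => ?_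
    exact sub_conj_ne_zero (hpos _ (hc ζ hζ)) (hpos _ hw₀).le
  have hmaps : MapsTo φ (Metric.ball 0 1) (Metric.closedBall 0 1) := by
    intro ζ hζ
    have hp := hpos _ (hc ζ hζ)
    have hp₀ := hpos _ hw₀
    rw [mem_closedBall_zero_iff, norm_div]
    refine div_le_one_of_le₀ ?_ (norm_nonneg _)
    refine le_of_sq_le_sq ?_ (norm_nonneg _)
    rw [← norm_sub_sq_add_four_im_mul_im]
    nlinarith [mul_pos hp hp₀]
  have h₀ : φ 0 = 0 := by simp [φ, c]
  have hwc : w - conj w₀ ≠ 0 := sub_conj_ne_zero hw' hw₀'.le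
  have hww : ‖w - w₀‖ ^ 2 + 4 * (w.im * w₀.im) = ‖w - conj w₀‖ ^ 2 :=
    norm_sub_sq_add_four_im_mul_im w w₀
  have hGG : ‖G w - G w₀‖ ^ 2 + 4 * ((G w).im * (G w₀).im) = ‖G w - conj (G w₀)‖ ^ 2 :=
    norm_sub_sq_add_four_im_mul_im _ _
  have hζ : ‖(w - w₀) / (w - conj w₀)‖ < 1 := by
    rw [norm_div, div_lt_one (norm_pos_iff.2 hwc)]
    refine lt_of_pow_lt_pow_left₀ 2 (norm_nonneg _) ?_
    nlinarith [mul_pos hw' hw₀']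
  have key := Complex.norm_le_norm_of_mapsTo_ball hd hmaps h₀ hζ
  have hcw : c ((w - w₀) / (w - conj w₀)) = w := by
    have h2 : w₀ - conj w₀ ≠ 0 := sub_conj_ne_zero hw₀' hw₀'.le
    have h3 : 1 - (w - w₀) / (w - conj w₀) = (w₀ - conj w₀) / (w - conj w₀) := by
      field_simp
      ring
    simp only [c]
    rw [h3]
    field_simp
    ring
  simp only [φ, hcw] at key
  rw [norm_div, norm_div, div_le_div_iff₀
    (norm_pos_iff.2 (sub_conj_ne_zero (hpos _ hw) (hpos _ hw₀).le)) (norm_pos_iff.2 hwc)] at key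
  have key2 := pow_le_pow_left₀ (by positivity) key 2
  rw [mul_pow, mul_pow] at key2
  nlinarith

/-- **Schwarz–Pick inequality** in the upper half-plane, in polynomial form. -/
theorem schwarz_pick {G : ℂ → ℂ} (hG : DifferentiableOn ℂ G UHP)
    (hnn : ∀ z ∈ UHP, 0 ≤ (G z).im) {w w₀ : ℂ} (hw : w ∈ UHP) (hw₀ : w₀ ∈ UHP) :
    w.im * w₀.im * ‖G w - conj (G w₀)‖ ^ 2 ≤
      (G w).im * (G w₀).im * ‖w - conj w₀‖ ^ 2 := by
  have h : ∀ᶠ δ : ℝ in 𝓝[>] 0,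
      w.im * w₀.im * ‖(G w + δ * I) - conj (G w₀ + δ * I)‖ ^ 2 ≤
      (G w + δ * I).im * (G w₀ + δ * I).im * ‖w - conj w₀‖ ^ 2 := by
    filter_upwards [self_mem_nhdsWithin] with δ hδ
    refine schwarz_pick_of_pos (G := fun z => G z + δ * I) (hG.add_const _) (fun z hz => ?_) hw hw₀
    have := hnn z hz
    have hδ' : 0 < δ := hδ
    simp
    linarith
  refine le_of_tendsto_of_tendsto ?_ ?_ h
  · have : Continuous fun δ : ℝ =>
        w.im * w₀.im * ‖(G w + δ * I) - conj (G w₀ + δ * I)‖ ^ 2 := by fun_prop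
    simpa using (this.tendsto 0).mono_left nhdsWithin_le_nhds
  · have : Continuous fun δ : ℝ =>
        (G w + δ * I).im * (G w₀ + δ * I).im * ‖w - conj w₀‖ ^ 2 := by fun_prop
    simpa using (this.tendsto 0).mono_left nhdsWithin_le_nhds

theorem isOpen_UHP_diff {K : Set ℂ} (hK : IsCompact K) : IsOpen (UHP \ K) :=
  isOpen_UHP.sdiff hK.isClosed

theorem not_eventually_const_of_injOn {U : Set ℂ} (hU : IsOpen U) {g : ℂ → ℂ} (hg : InjOn g U)
    {z : ℂ} (hz : z ∈ U) : ¬ ∀ᶠ y in 𝓝 z, g y = g z := by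
  intro h
  have h1 : ∀ᶠ y in 𝓝 z, y = z := by
    filter_upwards [h, hU.eventually_mem hz] with y hy hyU using hg hyU hz hy
  have h2 : ∀ᶠ y in 𝓝[≠] z, y = z := h1.filter_mono nhdsWithin_le_nhds
  obtain ⟨y, hy, hy'⟩ := (h2.and self_mem_nhdsWithin).exists
  exact hy' hy

/-- A left inverse of an injective holomorphic function is holomorphic. -/
theorem differentiableAt_of_leftInvOn {U : Set ℂ} (hU : IsOpen U) {g f : ℂ → ℂ}
    (hg : DifferentiableOn ℂ g U) (hfg : ∀ z ∈ U, f (g z) = z) {z : ℂ} (hz : z ∈ U) :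
    DifferentiableAt ℂ f (g z) := by
  have hinj : InjOn g U := fun a ha b hb hab => by rw [← hfg a ha, ← hfg b hb, hab]
  have han : ∀ y ∈ U, AnalyticAt ℂ g y := fun y hy => hg.analyticAt (hU.mem_nhds hy)
  have hopen : ∀ y ∈ U, 𝓝 (g y) ≤ map g (𝓝 y) := fun y hy =>
    ((han y hy).eventually_constant_or_nhds_le_map_nhds).resolve_left
      (not_eventually_const_of_injOn hU hinj hy)
  have hcont : ∀ y ∈ U, ContinuousAt f (g y) := by
    intro y hy N hN
    rw [hfg y hy] at hN
    rw [mem_map]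
    have : g '' (N ∩ U) ∈ 𝓝 (g y) :=
      hopen y hy (image_mem_map (inter_mem hN (hU.mem_nhds hy)))
    filter_upwards [this]
    rintro _ ⟨x, ⟨hxN, hxU⟩, rfl⟩
    rw [mem_preimage, hfg x hxU]
    exact hxN
  have hright : ∀ y ∈ U, ∀ᶠ w in 𝓝 (g y), g (f w) = w := by
    intro y hy
    have : g '' U ∈ 𝓝 (g y) := hopen y hy (image_mem_map (hU.mem_nhds hy))
    filter_upwards [this]
    rintro _ ⟨x, hxU, rfl⟩
    rw [hfg x hxU]
  have hdiff : ∀ y ∈ U, deriv g y ≠ 0 → DifferentiableAt ℂ f (g y) := by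
    intro y hy hne
    refine (HasDerivAt.of_local_left_inverse (f := g) (f' := deriv g y) (hcont y hy) ?_ hne
      (hright y hy)).differentiableAt
    rw [hfg y hy]
    exact (han y hy).differentiableAt.hasDerivAt
  have hder : ∀ᶠ y in 𝓝[≠] z, deriv g y ≠ 0 := by
    refine ((han z hz).deriv.eventually_eq_zero_or_eventually_ne_zero).resolve_left fun h => ?_
    obtain ⟨r, hr, hball⟩ := Metric.eventually_nhds_iff_ball.1 (h.and (hU.eventually_mem hz))
    refine not_eventually_const_of_injOn hU hinj hz ?_
    filter_upwards [Metric.ball_mem_nhds z hr] with y hy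
    refine (convex_ball z r).is_const_of_fderivWithin_eq_zero (𝕜 := ℂ)
      (hg.mono fun x hx => (hball x hx).2) (fun x hx => ?_) hy (Metric.mem_ball_self hr)
    rw [fderivWithin_of_isOpen Metric.isOpen_ball hx]
    ext
    simpa using (hball x hx).1
  refine (analyticAt_of_differentiable_on_punctured_nhds_of_continuousAt ?_
    (hcont z hz)).differentiableAt
  have hf : Tendsto f (𝓝[≠] (g z)) (𝓝[≠] z) := by
    refine tendsto_nhdsWithin_iff.2 ⟨?_, ?_⟩
    · have := (hcont z hz).tendsto
      rw [hfg z hz] at this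
      exact this.mono_left nhdsWithin_le_nhds
    · filter_upwards [self_mem_nhdsWithin, (hright z hz).filter_mono nhdsWithin_le_nhds] with w hw h
      rintro rfl
      exact hw h.symm
  have hUz : ∀ᶠ y in 𝓝[≠] z, y ∈ U := (hU.eventually_mem hz).filter_mono nhdsWithin_le_nhds
  filter_upwards [hf.eventually (hder.and hUz), (hright z hz).filter_mono nhdsWithin_le_nhds]
    with w hw h
  have := hdiff (f w) hw.2 hw.1
  rwa [h] at this

/-- `f` is the inverse of the mapping-out function `g` of `K`, with its normalization. -/
structure IsInverseMap (K : Set ℂ) (g f : ℂ → ℂ) : Prop where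
  differentiableOn : DifferentiableOn ℂ f UHP
  mapsTo : MapsTo f UHP (UHP \ K)
  right_inv : ∀ w ∈ UHP, g (f w) = w
  left_inv : ∀ z ∈ UHP \ K, f (g z) = z
  tendsto : Tendsto (fun w => f w - w) (cobounded ℂ ⊓ 𝓟 UHP) (𝓝 0)

theorem eventually_cobounded_inf_principal {p : ℂ → Prop} {s : Set ℂ} :
    (∀ᶠ z in cobounded ℂ ⊓ 𝓟 s, p z) ↔ ∃ M : ℝ, ∀ z ∈ s, M < ‖z‖ → p z := by
  rw [eventually_inf_principal, ← comap_norm_atTop, eventually_comap]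
  constructor
  · intro h
    obtain ⟨M, hM⟩ := eventually_atTop.1 h
    exact ⟨M, fun z hz hzM => hM _ hzM.le z rfl hz⟩
  · rintro ⟨M, hM⟩
    filter_upwards [eventually_gt_atTop M] with r hr z hzr hz
    exact hM z hz (hzr ▸ hr)

theorem isPreconnected_UHP_outside_box {M : ℝ} (hM : 0 ≤ M) :
    IsPreconnected {w : ℂ | 0 < w.im ∧ (M < w.im ∨ M < w.re ∨ w.re < -M)} := by
  have e : {w : ℂ | 0 < w.im ∧ (M < w.im ∨ M < w.re ∨ w.re < -M)} =
      ({w : ℂ | M < w.im} ∪ ({w : ℂ | 0 < w.im} ∩ {w : ℂ | M < w.re})) ∪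
        ({w : ℂ | 0 < w.im} ∩ {w : ℂ | w.re < -M}) := by
    ext w
    simp only [mem_ofPred_eq, mem_union, mem_inter_iff]
    constructor
    · tauto
    · rintro ((h | h) | h)
      · exact ⟨hM.trans_lt h, Or.inl h⟩
      · tauto
      · tauto
  rw [e]
  have h1 : IsPreconnected {w : ℂ | M < w.im} := (convex_halfSpace_im_gt M).isPreconnected
  have h2 : IsPreconnected ({w : ℂ | 0 < w.im} ∩ {w : ℂ | M < w.re}) :=
    ((convex_halfSpace_im_gt 0).inter (convex_halfSpace_re_gt M)).isPreconnected
  have h3 : IsPreconnected ({w : ℂ | 0 < w.im} ∩ {w : ℂ | w.re < -M}) :=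
    ((convex_halfSpace_im_gt 0).inter (convex_halfSpace_re_lt (-M))).isPreconnected
  refine (h1.union ⟨M + 1, M + 1⟩ ?_ ?_ h2).union ⟨-M - 1, M + 1⟩ ?_ ?_ h3
  · simp
  · simp; linarith
  · left; simp
  · simp; linarith

theorem norm_lt_of_box {w : ℂ} {M : ℝ} (h : M < w.im ∨ M < w.re ∨ w.re < -M) : M < ‖w‖ := by
  have h1 := abs_le.1 (Complex.abs_im_le_norm w)
  have h2 := abs_le.1 (Complex.abs_re_le_norm w)
  rcases h with h | h | h <;> linarith [h1.2, h2.1, h2.2]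

theorem box_of_norm_lt {w : ℂ} {M : ℝ} (hw : 0 < w.im) (h : 2 * M < ‖w‖) :
    M < w.im ∨ M < w.re ∨ w.re < -M := by
  by_contra! hc
  have := Complex.norm_le_abs_re_add_abs_im w
  have h1 : |w.re| ≤ M := abs_le.2 ⟨hc.2.2, hc.2.1⟩
  rw [abs_of_pos hw] at this
  linarith [hc.1]

theorem IsMappingOut.exists_inverse {K : Set ℂ} {g : ℂ → ℂ} (hK : IsCompact K)
    (h : IsMappingOut K g) : ∃ f, IsInverseMap K g f := by
  obtain ⟨hd, hbij, ht⟩ := h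
  have ho := isOpen_UHP_diff hK
  set f : ℂ → ℂ := Function.invFunOn g (UHP \ K)
  have hinv : InvOn f g (UHP \ K) UHP := hbij.invOn_invFunOn
  have hmaps : MapsTo f UHP (UHP \ K) := hbij.surjOn.mapsTo_invFunOn
  have hfd : DifferentiableOn ℂ f UHP := by
    intro w hw
    have := differentiableAt_of_leftInvOn ho hd hinv.1 (hmaps hw)
    rw [hinv.2 hw] at this
    exact this.differentiableWithinAt
  rw [comap_norm_atTop] at ht
  have hnorm : ∀ ε > 0, ∃ M : ℝ, 0 ≤ M ∧ ∀ z ∈ UHP \ K, M < ‖z‖ → ‖g z - z‖ < ε := by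
    intro ε hε
    have := ht (Metric.ball_mem_nhds 0 hε)
    obtain ⟨M, hM⟩ := eventually_cobounded_inf_principal.1 this
    refine ⟨max M 0, le_max_right _ _, fun z hz hzM => ?_⟩
    simpa using hM z hz ((le_max_left _ _).trans_lt hzM)
  obtain ⟨RK, hRK⟩ := hK.isBounded.exists_norm_le
  have hfar : ∀ N : ℝ, ∃ M : ℝ, ∀ w ∈ UHP, M < ‖w‖ → N < ‖f w‖ := by
    intro N₀
    obtain ⟨M₀, hM₀, hM₀'⟩ := hnorm 1 one_pos
    set N := max N₀ (max M₀ RK)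
    have hN₀ : N₀ ≤ N := le_max_left _ _
    have hNM : M₀ ≤ N := (le_max_left _ _).trans (le_max_right _ _)
    have hNR : RK ≤ N := (le_max_right _ _).trans (le_max_right _ _)
    refine ⟨2 * (N + 3), fun w hw hwM => ?_⟩
    by_contra! hcon
    have hV := isPreconnected_UHP_outside_box (M := N + 3) (by linarith)
    set V := {w : ℂ | 0 < w.im ∧ (N + 3 < w.im ∨ N + 3 < w.re ∨ w.re < -(N + 3))}
    have hVU : V ⊆ UHP := fun z hz => hz.1
    have hwV : w ∈ V := ⟨hw, box_of_norm_lt hw hwM⟩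
    have hcont : ContinuousOn (fun z => ‖f z‖) V := (hfd.continuousOn.mono hVU).norm
    set z₁ : ℂ := ⟨0, N + 5⟩
    have hz₁n : ‖z₁‖ = N + 5 := by
      have : z₁ = ((N + 5 : ℝ) : ℂ) * I := by apply Complex.ext <;> simp [z₁]
      rw [this, norm_mul, Complex.norm_I, mul_one, Complex.norm_real, Real.norm_eq_abs,
        abs_of_pos (by linarith)]
    have hz₁ : z₁ ∈ UHP \ K := by
      refine ⟨show 0 < N + 5 by linarith, fun hK' => ?_⟩
      have := hRK _ hK'
      linarith
    have hgz₁ : ‖g z₁ - z₁‖ < 1 := hM₀' z₁ hz₁ (by linarith)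
    have hgim : N + 3 < (g z₁).im := by
      have := (abs_le.1 (Complex.abs_im_le_norm (g z₁ - z₁))).1
      have e : z₁.im = N + 5 := rfl
      rw [Complex.sub_im, e] at this
      linarith
    have hg₁V : g z₁ ∈ V := ⟨by linarith, Or.inl hgim⟩
    have hmem : N + 1 ∈ (fun z => ‖f z‖) '' V := by
      refine hV.intermediate_value hwV hg₁V hcont ⟨by linarith, ?_⟩
      rw [hinv.1 hz₁, hz₁n]
      linarith
    obtain ⟨v, hvV, hv⟩ := hmem
    have hvN : N + 3 < ‖v‖ := norm_lt_of_box hvV.2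
    have := hM₀' (f v) (hmaps (hVU hvV)) (by simp only at hv; linarith)
    rw [hinv.2 (hVU hvV)] at this
    have h2 := norm_sub_norm_le v (f v)
    simp only at hv
    linarith
  refine ⟨f, hfd, hmaps, fun w hw => hinv.2 hw, fun z hz => hinv.1 hz, ?_⟩
  rw [Metric.tendsto_nhds]
  intro ε hε
  obtain ⟨M, -, hM⟩ := hnorm ε hε
  obtain ⟨M', hM'⟩ := hfar M
  refine eventually_cobounded_inf_principal.2 ⟨M', fun w hw hwM => ?_⟩
  have := hM (f w) (hmaps hw) (hM' w hw hwM)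
  rw [hinv.2 hw] at this
  rwa [dist_zero_right, norm_sub_rev]

/-- Along an ultrafilter tending to a boundary point of the half-plane, the inverse map tends to a
boundary point of the slit domain. -/
theorem IsInverseMap.exists_tendsto_boundary {K : Set ℂ} {g f : ℂ → ℂ} (hK : IsCompact K)
    (hg : IsMappingOut K g) (hf : IsInverseMap K g f) {F : Ultrafilter ℂ} {x : ℂ}
    (hFx : (F : Filter ℂ) ≤ 𝓝 x) (hFU : UHP ∈ F) (hx : x ∉ UHP) :
    ∃ z, Tendsto f F (𝓝 z) ∧ z ∉ UHP \ K ∧ 0 ≤ z.im := by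
  have hmem : ∀ᶠ w in (F : Filter ℂ), w ∈ UHP := hFU
  have hgt := hg.2.2
  rw [comap_norm_atTop] at hgt
  have hbdd : ∃ M : ℝ, ∀ᶠ w in (F : Filter ℂ), ‖f w‖ ≤ M := by
    by_contra! hcon
    obtain ⟨M, hM⟩ := eventually_cobounded_inf_principal.1 (hgt (Metric.ball_mem_nhds 0 one_pos))
    have h1 := hcon (max M (‖x‖ + 2))
    have h2 : ∀ᶠ w in (F : Filter ℂ), ‖w - x‖ < 1 := by
      filter_upwards [hFx (Metric.ball_mem_nhds x one_pos)] with w hw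
      simpa [dist_eq_norm] using hw
    obtain ⟨w, ⟨hw1, hw2⟩, hw3⟩ := ((h1.and h2).and hmem).exists
    have h3 := hM (f w) (hf.mapsTo hw3) ((le_max_left _ _).trans_lt hw1)
    simp only [hf.right_inv w hw3, mem_ball_zero_iff] at h3
    have h4 := (le_max_right M (‖x‖ + 2)).trans_lt hw1
    have h5 := norm_sub_norm_le (f w) w
    have h6 := norm_sub_norm_le w x
    rw [norm_sub_rev] at h5
    linarith
  obtain ⟨M, hM⟩ := hbdd
  have hle : ((F.map f : Ultrafilter ℂ) : Filter ℂ) ≤ 𝓟 (Metric.closedBall 0 M) := by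
    rw [le_principal_iff, Ultrafilter.mem_coe, Ultrafilter.mem_map]
    exact hM.mono fun w hw => by simpa using hw
  obtain ⟨z, -, hz⟩ := isCompact_iff_ultrafilter_le_nhds.1
    (isCompact_closedBall (0 : ℂ) M) (F.map f) hle
  have hz' : Tendsto f F (𝓝 z) := hz
  refine ⟨z, hz', fun hzΩ => ?_, ?_⟩
  · have hgc : ContinuousAt g z :=
      (hg.1.differentiableAt ((isOpen_UHP_diff hK).mem_nhds hzΩ)).continuousAt
    have h1 : Tendsto (fun w => g (f w)) F (𝓝 (g z)) := hgc.tendsto.comp hz'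
    have h2 : Tendsto (fun w : ℂ => w) F (𝓝 (g z)) :=
      h1.congr' (hmem.mono fun w hw => hf.right_inv w hw)
    have : x = g z := tendsto_nhds_unique hFx h2
    exact hx (this ▸ hg.2.1.mapsTo hzΩ)
  · have h1 : Tendsto (fun w => (f w).im) F (𝓝 z.im) := (Complex.continuous_im.tendsto z).comp hz'
    exact ge_of_tendsto h1 (hmem.mono fun w hw => le_of_lt (hf.mapsTo hw).1)

theorem tendsto_ofReal_mul_I :
    Tendsto (fun Y : ℝ => (Y : ℂ) * I) atTop (cobounded ℂ ⊓ 𝓟 UHP) := by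
  refine tendsto_inf.2 ⟨?_, tendsto_principal.2 ?_⟩
  · rw [← tendsto_norm_atTop_iff_cobounded]
    have : (fun Y : ℝ => ‖(Y : ℂ) * I‖) = fun Y => |Y| := by
      ext Y
      simp
    rw [this]
    exact tendsto_abs_atTop_atTop
  · filter_upwards [eventually_gt_atTop 0] with Y hY
    simpa [UHP] using hY

theorem tendsto_sub_conj_div (w : ℂ) {p : ℝ → ℂ}
    (hp : Tendsto (fun Y : ℝ => p Y - Y * I) atTop (𝓝 0)) :
    Tendsto (fun Y : ℝ => ‖w - conj (p Y)‖ ^ 2 / Y ^ 2) atTop (𝓝 1) := by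
  have h1 : Tendsto (fun Y : ℝ => conj (p Y - Y * I)) atTop (𝓝 0) := by
    have := (Complex.continuous_conj.tendsto 0).comp hp
    rw [map_zero] at this
    exact this
  have h2 : Tendsto (fun Y : ℝ => ((Y⁻¹ : ℝ) : ℂ)) atTop (𝓝 ((0 : ℝ) : ℂ)) :=
    (Complex.continuous_ofReal.tendsto 0).comp tendsto_inv_atTop_zero
  have h3 := ((tendsto_const_nhds (x := w)).sub h1).mul h2
  have h4 := ((h3.add_const I).norm).pow 2
  simp only [sub_zero, ofReal_zero, mul_zero, zero_add, norm_I, one_pow] at h4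
  refine h4.congr' ?_
  filter_upwards [eventually_gt_atTop 0] with Y hY
  have hY' : (Y : ℂ) ≠ 0 := by exact_mod_cast hY.ne'
  have e : (w - conj (p Y - Y * I)) * ((Y⁻¹ : ℝ) : ℂ) + I = (w - conj (p Y)) / Y := by
    push_cast
    simp only [map_sub, map_mul, conj_ofReal, conj_I]
    field_simp
    ring
  rw [e, norm_div, div_pow, Complex.norm_real, Real.norm_eq_abs, sq_abs]

theorem IsInverseMap.tendsto_imaginary {K : Set ℂ} {g f : ℂ → ℂ} (hf : IsInverseMap K g f) :
    Tendsto (fun Y : ℝ => f (Y * I) - Y * I) atTop (𝓝 0) :=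
  hf.tendsto.comp tendsto_ofReal_mul_I

theorem IsInverseMap.im_le {K : Set ℂ} {g f : ℂ → ℂ} (hf : IsInverseMap K g f) {w : ℂ}
    (hw : w ∈ UHP) : w.im ≤ (f w).im := by
  have h1 := tendsto_sub_conj_div (f w) hf.tendsto_imaginary
  have h2 := tendsto_sub_conj_div w (p := fun Y : ℝ => Y * I) (by simp)
  have h3 : Tendsto (fun Y : ℝ => (f (Y * I)).im / Y) atTop (𝓝 1) := by
    have := (Complex.continuous_im.tendsto 0).comp hf.tendsto_imaginary
    have := (this.mul tendsto_inv_atTop_zero).add_const 1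
    simp only [zero_im, mul_zero, zero_add] at this
    refine this.congr' ?_
    filter_upwards [eventually_gt_atTop 0] with Y hY
    simp
    field_simp
    ring
  have h4 := h1.const_mul w.im
  have h5 := (h3.const_mul (f w).im).mul h2
  simp only [mul_one] at h4 h5
  refine le_of_tendsto_of_tendsto h4 h5 ?_
  filter_upwards [eventually_gt_atTop 0] with Y hY
  have hYU : (Y : ℂ) * I ∈ UHP := by simpa [UHP] using hY
  have := schwarz_pick hf.differentiableOn (fun z hz => le_of_lt (hf.mapsTo hz).1) hw hYU
  simp only [mul_im, ofReal_re, I_im, mul_one, ofReal_im, I_re, mul_zero, add_zero] at this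
  have h6 : 0 < Y ^ 3 := by positivity
  rw [← mul_le_mul_iff_left₀ h6]
  calc _ = w.im * Y * ‖f w - conj (f (Y * I))‖ ^ 2 := by field_simp
    _ ≤ _ := this
    _ = _ := by field_simp

theorem IsInverseMap.tendsto_cobounded {K : Set ℂ} {g f : ℂ → ℂ} (hf : IsInverseMap K g f) :
    Tendsto f (cobounded ℂ ⊓ 𝓟 UHP) (cobounded ℂ ⊓ 𝓟 (UHP \ K)) := by
  refine tendsto_inf.2 ⟨?_, tendsto_principal.2 ?_⟩
  · rw [← tendsto_norm_atTop_iff_cobounded]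
    have h1 : Tendsto (fun w : ℂ => ‖w‖) (cobounded ℂ ⊓ 𝓟 UHP) atTop :=
      tendsto_norm_cobounded_atTop.mono_left inf_le_left
    refine tendsto_atTop_mono' _ ?_ (tendsto_atTop_add_const_right _ (-1) h1)
    filter_upwards [hf.tendsto (Metric.ball_mem_nhds 0 one_pos)] with w hw
    have h2 := norm_sub_norm_le w (f w)
    rw [mem_preimage, mem_ball_zero_iff, norm_sub_rev] at hw
    linarith
  · exact mem_inf_of_right fun w hw => hf.mapsTo hw

/-- Quantitative form of the Nevanlinna representation of the inverse map. -/
theorem IsInverseMap.im_mul_sq_le {K : Set ℂ} {g f : ℂ → ℂ} (hf : IsInverseMap K g f) {a : ℝ}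
    (ha : Tendsto (fun z => z * (g z - z)) (cobounded ℂ ⊓ 𝓟 (UHP \ K)) (𝓝 (a : ℂ)))
    {w : ℂ} (hw : w ∈ UHP) : w.im * ‖f w - w‖ ^ 2 ≤ a * (f w - w).im := by
  have hlim : Tendsto (fun w => w * (f w - w)) (cobounded ℂ ⊓ 𝓟 UHP) (𝓝 (-(a : ℂ))) := by
    have h1 := ((ha.comp hf.tendsto_cobounded).neg).sub (hf.tendsto.pow 2)
    simp only [ne_eq, OfNat.ofNat_ne_zero, not_false_eq_true, zero_pow, sub_zero] at h1
    refine h1.congr' ?_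
    filter_upwards [mem_inf_of_right (mem_principal_self UHP)] with w hw
    simp only [Function.comp_apply, hf.right_inv w hw]
    ring
  have hy : Tendsto (fun Y : ℝ => Y * (f (Y * I) - Y * I).im) atTop (𝓝 a) := by
    have := ((Complex.continuous_re.tendsto _).comp (hlim.comp tendsto_ofReal_mul_I)).neg
    simp only [neg_re, ofReal_re, neg_neg] at this
    refine this.congr fun Y => ?_
    simp
  have h2 := tendsto_sub_conj_div w (p := fun Y : ℝ => Y * I) (by simp)
  have h3 : Tendsto (fun Y : ℝ => w.im * ‖(f w - w) - conj (f (Y * I) - Y * I)‖ ^ 2) atTop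
      (𝓝 (w.im * ‖f w - w‖ ^ 2)) := by
    have h := (Complex.continuous_conj.tendsto 0).comp hf.tendsto_imaginary
    have := (((tendsto_const_nhds (x := f w - w)).sub h).norm.pow 2).const_mul w.im
    simpa using this
  have h4 := (hy.const_mul (f w - w).im).mul h2
  rw [mul_one, mul_comm _ a] at h4
  refine le_of_tendsto_of_tendsto h3 h4 ?_
  filter_upwards [eventually_gt_atTop 0] with Y hY
  have hYU : (Y : ℂ) * I ∈ UHP := by simpa [UHP] using hY
  have hd : DifferentiableOn ℂ (fun w => f w - w) UHP := hf.differentiableOn.sub differentiableOn_id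
  have := schwarz_pick hd (fun z hz => by simpa using hf.im_le hz) hw hYU
  simp only [mul_im (Y : ℂ), ofReal_re, I_im, mul_one, ofReal_im, I_re, mul_zero, add_zero] at this
  rw [← mul_le_mul_iff_left₀ hY]
  calc _ = w.im * Y * ‖(f w - w) - conj (f (Y * I) - Y * I)‖ ^ 2 := by ring
    _ ≤ _ := this
    _ = _ := by field_simp

theorem HasHCap.nonneg {K : Set ℂ} (hK : IsCompact K) {a : ℝ} (h : HasHCap K a) : 0 ≤ a := by
  obtain ⟨g, hg, ha⟩ := h
  rw [comap_norm_atTop] at ha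
  obtain ⟨f, hf⟩ := hg.exists_inverse hK
  by_contra! hneg
  have hw : I ∈ UHP := by simp [UHP]
  have h1 := hf.im_mul_sq_le ha hw
  have h2 := hf.im_le hw
  have h4 : ∀ᶠ w in cobounded ℂ ⊓ 𝓟 UHP, f w = w := by
    filter_upwards [mem_inf_of_right (mem_principal_self UHP)] with w hw
    have h1 := hf.im_mul_sq_le ha hw
    have h2 := hf.im_le hw
    have h3 : 0 ≤ (f w - w).im := by simpa using h2
    have h5 : w.im * ‖f w - w‖ ^ 2 ≤ 0 := h1.trans (by nlinarith)
    have h6 : 0 < w.im := hw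
    have h7 : ‖f w - w‖ ^ 2 ≤ 0 := by nlinarith [sq_nonneg ‖f w - w‖]
    have h8 : ‖f w - w‖ = 0 := by nlinarith [norm_nonneg (f w - w)]
    exact sub_eq_zero.1 (norm_eq_zero.1 h8)
  have h5 : Tendsto (fun w : ℂ => (0 : ℂ)) (cobounded ℂ ⊓ 𝓟 UHP) (𝓝 (a : ℂ)) := by
    refine (ha.comp hf.tendsto_cobounded).congr' ?_
    filter_upwards [h4, mem_inf_of_right (mem_principal_self UHP)] with w hw hwU
    simp only [Function.comp_apply, hf.right_inv w hwU]
    rw [hw, sub_self, mul_zero]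
  have h6 := tendsto_nhds_unique (h5.comp tendsto_ofReal_mul_I) tendsto_const_nhds
  have h7 := congrArg Complex.re h6
  simp only [ofReal_re] at h7
  linarith

/-- A hull reaching height `h` has half-plane capacity at least `h ^ 2 / 4`. -/
theorem HasHCap.im_sq_le {K : Set ℂ} (hK : IsCompact K) {a : ℝ} (h : HasHCap K a) {ζ : ℂ}
    (hζ : ζ ∈ K) (hζim : 0 ≤ ζ.im) : ζ.im ^ 2 ≤ 4 * a := by
  have ha0 := h.nonneg hK
  obtain ⟨g, hg, ha⟩ := h
  rw [comap_norm_atTop] at ha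
  obtain ⟨f, hf⟩ := hg.exists_inverse hK
  obtain ⟨p, hp, hmax⟩ := hK.exists_isMaxOn ⟨ζ, hζ⟩ Complex.continuous_im.continuousOn
  have hζp : ζ.im ≤ p.im := hmax hζ
  suffices hs : p.im ^ 2 ≤ 4 * a by nlinarith
  rcases (hζim.trans hζp).eq_or_lt with h0 | hpos
  · rw [← h0]; linarith
  set b := p.im
  have hbound : ∀ w ∈ UHP, w.im * ‖f w - w‖ ≤ a := by
    intro w hw
    have h1 := hf.im_mul_sq_le ha hw
    have h2 : (f w - w).im ≤ ‖f w - w‖ := (le_abs_self _).trans (Complex.abs_im_le_norm _)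
    rcases (norm_nonneg (f w - w)).eq_or_lt with h3 | h3
    · rw [← h3]; simpa using ha0
    · have h4 : w.im * ‖f w - w‖ ^ 2 ≤ a * ‖f w - w‖ := h1.trans (by gcongr)
      refine le_of_mul_le_mul_right ?_ h3
      calc _ = w.im * ‖f w - w‖ ^ 2 := by ring
        _ ≤ _ := h4
  set c : ℝ → ℂ := fun δ => p + δ * I
  have hcim : ∀ δ : ℝ, (c δ).im = b + δ := fun δ => by simp [c, b]
  have hcΩ : ∀ δ ∈ Ioi (0 : ℝ), c δ ∈ UHP \ K := by
    intro δ hδ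
    have hδ' : 0 < δ := hδ
    refine ⟨?_, fun hcK => ?_⟩
    · change 0 < (c δ).im
      rw [hcim]; linarith
    · have := hmax hcK
      simp only [mem_ofPred_eq, hcim] at this
      linarith
  have hgb : ∀ δ ∈ Ioi (0 : ℝ), (g (c δ)).im * ‖c δ - g (c δ)‖ ≤ a := by
    intro δ hδ
    have := hbound _ (hg.2.1.mapsTo (hcΩ δ hδ))
    rwa [hf.left_inv _ (hcΩ δ hδ)] at this
  have hcc : Continuous c := by fun_prop
  have hmc : ContinuousOn (fun δ => (g (c δ)).im) (Ioi 0) :=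
    Complex.continuous_im.comp_continuousOn (hg.1.continuousOn.comp hcc.continuousOn hcΩ)
  have hsmall : ∃ δ ∈ Ioi (0 : ℝ), (g (c δ)).im ≤ b / 2 := by
    by_contra! hcon
    let F : Ultrafilter ℝ := Ultrafilter.of (𝓝[>] 0)
    have hF : (F : Filter ℝ) ≤ 𝓝[>] 0 := Ultrafilter.of_le _
    have hF0 : Tendsto (fun δ : ℝ => δ) F (𝓝 0) := hF.trans nhdsWithin_le_nhds
    have hFc : Tendsto c F (𝓝 p) := by
      have := (hcc.tendsto 0).comp hF0
      simp only [c, ofReal_zero, zero_mul, add_zero] at this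
      exact this
    have hFpos : ∀ᶠ δ in (F : Filter ℝ), δ ∈ Ioi (0 : ℝ) := hF self_mem_nhdsWithin
    have hb : ∀ᶠ δ in (F : Filter ℝ), ‖g (c δ)‖ ≤ ‖p‖ + 1 + 2 * a / b := by
      filter_upwards [hFpos, hFc (Metric.ball_mem_nhds p one_pos)] with δ hδ hδc
      rw [mem_preimage, Metric.mem_ball, dist_eq_norm] at hδc
      have h1 := hgb δ hδ
      have h2 := hcon δ hδ
      have h3 : ‖c δ - g (c δ)‖ ≤ 2 * a / b := by
        rw [le_div_iff₀ hpos]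
        nlinarith [norm_nonneg (c δ - g (c δ))]
      have h4 := norm_sub_norm_le (g (c δ)) (c δ)
      have h5 := norm_sub_norm_le (c δ) p
      rw [norm_sub_rev] at h4
      linarith
    have hle : ((F.map fun δ => g (c δ) : Ultrafilter ℂ) : Filter ℂ) ≤
        𝓟 (Metric.closedBall 0 (‖p‖ + 1 + 2 * a / b)) := by
      rw [le_principal_iff, Ultrafilter.mem_coe, Ultrafilter.mem_map]
      exact hb.mono fun w hw => by simpa using hw
    obtain ⟨w, -, hw⟩ := isCompact_iff_ultrafilter_le_nhds.1 (isCompact_closedBall (0 : ℂ) _) _ hle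
    have hw' : Tendsto (fun δ => g (c δ)) F (𝓝 w) := hw
    have hwim : b / 2 ≤ w.im :=
      ge_of_tendsto ((Complex.continuous_im.tendsto w).comp hw')
        (hFpos.mono fun δ hδ => (hcon δ hδ).le)
    have hwU : w ∈ UHP := by
      change 0 < w.im
      linarith
    have hfc : ContinuousAt f w :=
      (hf.differentiableOn.differentiableAt (isOpen_UHP.mem_nhds hwU)).continuousAt
    have h1 : Tendsto c F (𝓝 (f w)) :=
      (hfc.tendsto.comp hw').congr' (hFpos.mono fun δ hδ => hf.left_inv _ (hcΩ δ hδ))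
    have h2 : p = f w := tendsto_nhds_unique hFc h1
    exact (hf.mapsTo hwU).2 (h2 ▸ hp)
  obtain ⟨δ₁, hδ₁, hδ₁'⟩ := hsmall
  have hlarge : ∃ δ ∈ Ioi (0 : ℝ), b / 2 ≤ (g (c δ)).im := by
    have hgt := hg.2.2
    rw [comap_norm_atTop] at hgt
    obtain ⟨M, hM⟩ := eventually_cobounded_inf_principal.1 (hgt (Metric.ball_mem_nhds 0 one_pos))
    have hδ : max M 0 + 1 ∈ Ioi (0 : ℝ) := by
      have := le_max_right M 0
      rw [mem_Ioi]; linarith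
    refine ⟨_, hδ, ?_⟩
    have h0 : b + (max M 0 + 1) ≤ ‖c (max M 0 + 1)‖ := by
      rw [← hcim]
      exact (le_abs_self _).trans (Complex.abs_im_le_norm _)
    have h1 := hM _ (hcΩ _ hδ) (by have := le_max_left M 0; linarith)
    rw [mem_ball_zero_iff] at h1
    have h2 := (abs_le.1 ((Complex.abs_im_le_norm _).trans h1.le)).1
    rw [sub_im, hcim] at h2
    have := le_max_right M 0
    linarith
  obtain ⟨δ₂, hδ₂, hδ₂'⟩ := hlarge
  obtain ⟨δ, hδ, hδe⟩ := isPreconnected_Ioi.intermediate_value hδ₁ hδ₂ hmc ⟨hδ₁', hδ₂'⟩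
  have h1 := hgb δ hδ
  simp only at hδe
  have h2 : (c δ - g (c δ)).im ≤ ‖c δ - g (c δ)‖ :=
    (le_abs_self _).trans (Complex.abs_im_le_norm _)
  rw [sub_im, hcim, hδe] at h2
  rw [hδe] at h1
  have hδ' : 0 < δ := hδ
  nlinarith

/-- The branch of `log (T - z)`, `T = X₀ + i φ(X₀)`, on the complement of the graph of `φ` over
`[X₀, ∞)`. -/
noncomputable def graphLog (φ : ℝ → ℝ) (X₀ : ℝ) (z : ℂ) : ℂ :=
  if z.re ≤ X₀ then log (-(z - ⟨X₀, φ X₀⟩))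
  else if φ z.re < z.im then log (z - ⟨X₀, φ X₀⟩) - Real.pi * I
  else log (z - ⟨X₀, φ X₀⟩) + Real.pi * I

section GraphLog

variable {φ : ℝ → ℝ} {X₀ : ℝ} {z : ℂ}

theorem graphLog_of_le (h : z.re ≤ X₀) : graphLog φ X₀ z = log (-(z - ⟨X₀, φ X₀⟩)) :=
  if_pos h

theorem graphLog_of_above (h : X₀ < z.re) (h' : φ z.re < z.im) :
    graphLog φ X₀ z = log (z - ⟨X₀, φ X₀⟩) - Real.pi * I := by
  rw [graphLog, if_neg h.not_ge, if_pos h']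

theorem graphLog_of_below (h : X₀ < z.re) (h' : z.im ≤ φ z.re) :
    graphLog φ X₀ z = log (z - ⟨X₀, φ X₀⟩) + Real.pi * I := by
  rw [graphLog, if_neg h.not_ge, if_neg h'.not_gt]

theorem exp_graphLog (hz : z ≠ ⟨X₀, φ X₀⟩) : exp (graphLog φ X₀ z) = -(z - ⟨X₀, φ X₀⟩) := by
  have h0 := sub_ne_zero.2 hz
  rcases le_or_gt z.re X₀ with h | h
  · rw [graphLog_of_le h, exp_log (neg_ne_zero.2 h0)]
  rcases lt_or_ge (φ z.re) z.im with h' | h'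
  · rw [graphLog_of_above h h', exp_sub, exp_log h0, exp_pi_mul_I, div_neg, div_one]
  · rw [graphLog_of_below h h', exp_add, exp_log h0, exp_pi_mul_I]
    simp

theorem abs_graphLog_im_le : |(graphLog φ X₀ z).im| ≤ 3 * Real.pi / 2 := by
  have hpi := Real.pi_pos
  rcases le_or_gt z.re X₀ with h | h
  · rw [graphLog_of_le h, log_im]
    have := abs_arg_le_pi (-(z - ⟨X₀, φ X₀⟩))
    linarith
  have hre : 0 ≤ (z - ⟨X₀, φ X₀⟩).re := by simpa using h.le
  have := abs_le.1 (abs_arg_le_pi_div_two_iff.2 hre)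
  rcases lt_or_ge (φ z.re) z.im with h' | h'
  · rw [graphLog_of_above h h', abs_le]
    simp only [sub_im, log_im, mul_im, ofReal_re, I_im, mul_one, ofReal_im, I_re, mul_zero,
      add_zero]
    constructor <;> linarith [this.1, this.2]
  · rw [graphLog_of_below h h', abs_le]
    simp only [add_im, log_im, mul_im, ofReal_re, I_im, mul_one, ofReal_im, I_re, mul_zero,
      add_zero]
    constructor <;> linarith [this.1, this.2]

theorem log_neg_eq_sub_of_im_pos {u : ℂ} (hu : 0 < u.im) : log (-u) = log u - Real.pi * I := by
  rw [log, log, norm_neg, arg_neg_eq_arg_sub_pi_of_im_pos hu]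
  push_cast
  ring

theorem log_neg_eq_add_of_im_neg {u : ℂ} (hu : u.im < 0) : log (-u) = log u + Real.pi * I := by
  rw [log, log, norm_neg, arg_neg_eq_arg_add_pi_of_im_neg hu]
  push_cast
  ring

theorem isOpen_above (hφ : Continuous φ) : IsOpen {z : ℂ | φ z.re < z.im} :=
  isOpen_lt (by fun_prop) (by fun_prop)

theorem isOpen_below (hφ : Continuous φ) : IsOpen {z : ℂ | z.im < φ z.re} :=
  isOpen_lt (by fun_prop) (by fun_prop)

theorem differentiableAt_graphLog (hφ : Continuous φ) (hz : X₀ ≤ z.re → z.im ≠ φ z.re) :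
    DifferentiableAt ℂ (graphLog φ X₀) z := by
  set T : ℂ := ⟨X₀, φ X₀⟩ with hT
  rcases lt_or_ge z.re X₀ with h | h
  · have hd : DifferentiableAt ℂ (fun z => log (-(z - T))) z :=
      DifferentiableAt.clog (by fun_prop) (Or.inl (by simpa [hT] using h))
    refine hd.congr_of_eventuallyEq ?_
    filter_upwards [(isOpen_lt continuous_re continuous_const).mem_nhds h] with w hw
    exact graphLog_of_le (le_of_lt hw)
  have hslit : z - T ∈ slitPlane := by
    rw [mem_slitPlane_iff]
    rcases h.eq_or_lt with h' | h'
    · refine Or.inr ?_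
      have := hz h
      rw [← h'] at this
      simpa [hT, sub_eq_zero] using this
    · exact Or.inl (by simpa [hT] using h')
  have hd : DifferentiableAt ℂ (fun z => log (z - T)) z :=
    DifferentiableAt.clog (by fun_prop) hslit
  rcases (hz h).lt_or_gt with hlt | hgt
  · refine (hd.add_const (Real.pi * I)).congr_of_eventuallyEq ?_
    rcases h.eq_or_lt with h' | h'
    · have him : z.im < T.im := by simpa [hT, h'] using hlt
      filter_upwards [(isOpen_below hφ).mem_nhds hlt,
        (isOpen_lt continuous_im continuous_const).mem_nhds him] with w hw hw'
      rcases le_or_gt w.re X₀ with h1 | h1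
      · rw [graphLog_of_le h1, log_neg_eq_add_of_im_neg]
        simpa [hT] using hw'
      · exact graphLog_of_below h1 (le_of_lt hw)
    · filter_upwards [(isOpen_below hφ).mem_nhds hlt,
        (isOpen_lt continuous_const continuous_re).mem_nhds h'] with w hw hw'
      exact graphLog_of_below hw' (le_of_lt hw)
  · refine (hd.sub_const (Real.pi * I)).congr_of_eventuallyEq ?_
    rcases h.eq_or_lt with h' | h'
    · have him : T.im < z.im := by simpa [hT, h'] using hgt
      filter_upwards [(isOpen_above hφ).mem_nhds hgt,
        (isOpen_lt continuous_const continuous_im).mem_nhds him] with w hw hw'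
      rcases le_or_gt w.re X₀ with h1 | h1
      · rw [graphLog_of_le h1, log_neg_eq_sub_of_im_pos]
        simpa [hT] using hw'
      · exact graphLog_of_above h1 hw
    · filter_upwards [(isOpen_above hφ).mem_nhds hgt,
        (isOpen_lt continuous_const continuous_re).mem_nhds h'] with w hw hw'
      exact graphLog_of_above hw' hw

end GraphLog

theorem tendsto_mul_log_one_add {α : Type*} {l : Filter α} {w e : α → ℂ} {c : ℂ}
    (he : Tendsto e l (𝓝 0)) (hwe : Tendsto (fun a => w a * e a) l (𝓝 c)) :
    Tendsto (fun a => w a * log (1 + e a)) l (𝓝 c) := by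
  have h0 : HasDerivAt (fun z => log (1 + z)) 1 (0 : ℂ) := by
    have := ((hasDerivAt_id (0 : ℂ)).const_add 1).clog (by simp)
    simpa using this
  have h1 := (hasDerivAt_iff_isLittleO.1 h0).comp_tendsto he
  have h2 : (fun a => w a * (log (1 + e a) - e a)) =o[l] fun a => w a * e a := by
    refine (Asymptotics.isBigO_refl w l).mul_isLittleO ?_
    refine h1.congr (fun a => ?_) (fun a => ?_) <;> simp
  have h3 : Tendsto (fun a => w a * (log (1 + e a) - e a)) l (𝓝 0) :=
    (Asymptotics.isLittleO_one_iff ℂ).1 (h2.trans_isBigO (hwe.isBigO_one ℂ))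
  have := h3.add hwe
  rw [zero_add] at this
  exact this.congr fun a => by ring

theorem eq_log_exp {d : ℂ} (hd : |d.im| ≤ 3 * Real.pi / 2) (he : 0 < (exp d).re) :
    d = log (exp d) := by
  have hpi := Real.pi_pos
  have h1 : 0 < Real.cos d.im := by
    rw [exp_re] at he
    exact pos_of_mul_pos_right he (Real.exp_pos _).le
  have h2 : |d.im| < Real.pi / 2 := by
    by_contra! h
    have := Real.cos_nonpos_of_pi_div_two_le_of_le h (by linarith)
    rw [Real.cos_abs] at this
    linarith
  have := abs_lt.1 h2
  rw [log_exp (by linarith [this.1]) (by linarith [this.2])]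

theorem neg_I_mul_re (z : ℂ) : (-I * z).re = z.im := by simp
theorem neg_I_mul_im (z : ℂ) : (-I * z).im = -z.re := by simp

theorem abs_arg_neg_I_mul_lt {z : ℂ} (hz : z ∈ UHP) : |arg (-I * z)| < Real.pi / 2 :=
  abs_arg_lt_pi_div_two_iff.2 (Or.inl (by rwa [neg_I_mul_re]))

theorem ne_zero_of_mem_UHP {z : ℂ} (hz : z ∈ UHP) : z ≠ 0 := by
  rintro rfl
  exact lt_irrefl (0 : ℝ) hz

theorem tendsto_div_sq_cobounded (T : ℂ) :
    Tendsto (fun z : ℂ => T / z ^ 2) (cobounded ℂ) (𝓝 0) := by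
  have h := (tendsto_inv₀_cobounded (α := ℂ)).pow 2
  have := h.const_mul T
  simpa [div_eq_mul_inv] using this

theorem eventually_graphLog_sq {φ : ℝ → ℝ} {X₀ : ℝ} (hφ : Continuous φ)
    (hφ0 : ∀ X, 0 ≤ X → φ X = 0) :
    ∀ᶠ z in cobounded ℂ ⊓ 𝓟 UHP,
      graphLog φ X₀ (z ^ 2) - 2 * log (-I * z) = log (1 + -(⟨X₀, φ X₀⟩ / z ^ 2)) := by
  set T : ℂ := ⟨X₀, φ X₀⟩ with hT
  obtain ⟨M, hM⟩ := isCompact_Icc.exists_bound_of_continuousOn (s := Icc X₀ 0) hφ.continuousOn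
  have hpi := Real.pi_pos
  have hsq : Tendsto (fun z : ℂ => ‖z ^ 2‖) (cobounded ℂ ⊓ 𝓟 UHP) atTop := by
    have : Tendsto (fun z : ℂ => ‖z‖) (cobounded ℂ ⊓ 𝓟 UHP) atTop :=
      tendsto_norm_cobounded_atTop.mono_left inf_le_left
    simpa only [norm_pow, Function.comp_def] using (tendsto_pow_atTop two_ne_zero).comp this
  filter_upwards [mem_inf_of_right (mem_principal_self UHP),
    hsq.eventually_gt_atTop (|X₀| + |M|), hsq.eventually_gt_atTop ‖T‖,
    mem_inf_of_left (tendsto_div_sq_cobounded T (Metric.ball_mem_nhds 0 one_pos))]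
    with z hz hzM hzT hz1
  have hz0 := ne_zero_of_mem_UHP hz
  have hzT' : z ^ 2 ≠ T := by
    rintro h
    rw [h] at hzT
    exact lt_irrefl _ hzT
  have hiz : -I * z ≠ 0 := mul_ne_zero (by simp) hz0
  have hexp : exp (graphLog φ X₀ (z ^ 2) - 2 * log (-I * z)) = 1 + -(T / z ^ 2) := by
    rw [exp_sub, exp_graphLog hzT', two_mul, exp_add, exp_log hiz]
    field_simp
    simp [← hT]
    ring
  have hre : 0 < (exp (graphLog φ X₀ (z ^ 2) - 2 * log (-I * z))).re := by
    rw [mem_preimage, mem_ball_zero_iff] at hz1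
    have := (le_abs_self _).trans (Complex.abs_re_le_norm (T / z ^ 2))
    rw [hexp, add_re, neg_re, one_re]
    linarith
  rw [eq_log_exp ?_ hre, hexp]
  have ha := abs_lt.1 (abs_arg_neg_I_mul_lt hz)
  have him2 : (2 * log (-I * z)).im = 2 * arg (-I * z) := by
    rw [two_mul, add_im, log_im]
    ring
  have hsqim : (z ^ 2).im = 2 * z.re * z.im := by
    rw [pow_two, mul_im]; ring
  have hzim : 0 < z.im := hz
  have hlarge : (z ^ 2).re ∈ Icc X₀ 0 → |φ (z ^ 2).re| < |(z ^ 2).im| := by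
    intro h
    have h1 := hM _ h
    rw [Real.norm_eq_abs] at h1
    have h2 := norm_le_abs_re_add_abs_im (z ^ 2)
    have h3 : |(z ^ 2).re| ≤ |X₀| := abs_le_abs_of_nonpos h.2 h.1
    linarith [le_abs_self M]
  rw [sub_im, him2]
  rcases le_or_gt (z ^ 2).re X₀ with h | h
  · rw [graphLog_of_le h, log_im]
    have h1 : 0 ≤ (-(z ^ 2 - T)).re := by simpa [hT] using h
    have h2 := abs_le.1 (abs_arg_le_pi_div_two_iff.2 h1)
    rw [abs_le]
    constructor <;> linarith [h2.1, h2.2, ha.1, ha.2]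
  have h1 : 0 ≤ (z ^ 2 - T).re := by simpa [hT] using h.le
  have h2 := abs_le.1 (abs_arg_le_pi_div_two_iff.2 h1)
  rcases lt_or_ge (φ (z ^ 2).re) (z ^ 2).im with h' | h'
  · have him : 0 < (z ^ 2).im := by
      rcases le_or_gt 0 (z ^ 2).re with h3 | h3
      · rwa [hφ0 _ h3] at h'
      · by_contra! h4
        have h5 := hlarge ⟨h.le, h3.le⟩
        rw [abs_of_nonpos h4] at h5
        linarith [neg_abs_le (φ (z ^ 2).re)]
    have hzre : 0 < z.re := by
      rw [hsqim] at him
      nlinarith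
    have h6 : arg (-I * z) < 0 := arg_neg_iff.2 (by rw [neg_I_mul_im]; linarith)
    rw [graphLog_of_above h h', abs_le]
    simp only [sub_im, log_im, mul_im, ofReal_re, I_im, mul_one, ofReal_im, I_re, mul_zero,
      add_zero]
    constructor <;> linarith [h2.1, h2.2, ha.1, ha.2]
  · have him : (z ^ 2).im ≤ 0 := by
      rcases le_or_gt 0 (z ^ 2).re with h3 | h3
      · rwa [hφ0 _ h3] at h'
      · by_contra! h4
        have h5 := hlarge ⟨h.le, h3.le⟩
        rw [abs_of_pos h4] at h5
        linarith [le_abs_self (φ (z ^ 2).re)]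
    have hzre : z.re ≤ 0 := by
      rw [hsqim] at him
      nlinarith
    have h6 : 0 ≤ arg (-I * z) := arg_nonneg_iff.2 (by rw [neg_I_mul_im]; linarith)
    rw [graphLog_of_below h h', abs_le]
    simp only [add_im, log_im, mul_im, ofReal_re, I_im, mul_one, ofReal_im, I_re, mul_zero,
      add_zero]
    constructor <;> linarith [h2.1, h2.2, ha.1, ha.2]

theorem log_neg_I_mul_sub {z w : ℂ} (hz : z ∈ UHP) (hw : w ∈ UHP) :
    log (-I * z) - log (-I * w) = log (z / w) := by
  have h1 := abs_lt.1 (abs_arg_neg_I_mul_lt hz)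
  have h2 := abs_lt.1 (abs_arg_neg_I_mul_lt hw)
  have hz0 : -I * z ≠ 0 := mul_ne_zero (by simp) (ne_zero_of_mem_UHP hz)
  have hw0 : -I * w ≠ 0 := mul_ne_zero (by simp) (ne_zero_of_mem_UHP hw)
  have h : exp (log (-I * z) - log (-I * w)) = z / w := by
    rw [exp_sub, exp_log hz0, exp_log hw0, mul_div_mul_left _ _ (by simp)]
  rw [← h, log_exp] <;> rw [sub_im, log_im, log_im] <;> linarith [h1.1, h1.2, h2.1, h2.2]

/-- The logarithm of the conjugated square-root map, normalized at infinity. -/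
noncomputable def slitPsi (φ : ℝ → ℝ) (X₀ W : ℝ) (f : ℂ → ℂ) (w : ℂ) : ℂ :=
  graphLog φ X₀ (f w ^ 2) / 2 - log (-I * (w - W))

theorem sub_ofReal_mem_UHP {w : ℂ} (hw : w ∈ UHP) (W : ℝ) : w - W ∈ UHP := by
  simpa [UHP] using hw

theorem IsInverseMap.eventually_slitPsi {K : Set ℂ} {g f : ℂ → ℂ} (hf : IsInverseMap K g f)
    {φ : ℝ → ℝ} {X₀ : ℝ} (hφ : Continuous φ) (hφ0 : ∀ X, 0 ≤ X → φ X = 0) (W : ℝ) :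
    ∀ᶠ w in cobounded ℂ ⊓ 𝓟 UHP, slitPsi φ X₀ W f w =
      log (1 + -(⟨X₀, φ X₀⟩ / f w ^ 2)) / 2 + log (1 + (f w - w + W) / (w - W)) := by
  have h1 : Tendsto f (cobounded ℂ ⊓ 𝓟 UHP) (cobounded ℂ ⊓ 𝓟 UHP) :=
    hf.tendsto_cobounded.mono_right (inf_le_inf_left _ (principal_mono.2 sdiff_subset))
  filter_upwards [h1.eventually (eventually_graphLog_sq hφ hφ0),
    mem_inf_of_right (mem_principal_self UHP)] with w hw hwU
  have h2 := sub_ofReal_mem_UHP hwU W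
  have h3 := log_neg_I_mul_sub (hf.mapsTo hwU).1 h2
  have h4 := ne_zero_of_mem_UHP h2
  have h5 : 1 + (f w - w + W) / (w - W) = f w / (w - W) := by
    field_simp
    ring
  rw [← hw, h5, ← h3, slitPsi]
  ring

theorem IsInverseMap.tendsto_mul_slitPsi {K : Set ℂ} {g f : ℂ → ℂ} (hf : IsInverseMap K g f)
    {φ : ℝ → ℝ} {X₀ : ℝ} (hφ : Continuous φ) (hφ0 : ∀ X, 0 ≤ X → φ X = 0) (W : ℝ) :
    Tendsto (fun w => w * slitPsi φ X₀ W f w) (cobounded ℂ ⊓ 𝓟 UHP) (𝓝 W) := by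
  set T : ℂ := ⟨X₀, φ X₀⟩ with hT
  have hfc : Tendsto f (cobounded ℂ ⊓ 𝓟 UHP) (cobounded ℂ) :=
    hf.tendsto_cobounded.mono_right inf_le_left
  have hfinv : Tendsto (fun w => (f w)⁻¹) (cobounded ℂ ⊓ 𝓟 UHP) (𝓝 0) :=
    tendsto_inv₀_cobounded.comp hfc
  have hfne : ∀ᶠ w in cobounded ℂ ⊓ 𝓟 UHP, f w ≠ 0 := by
    filter_upwards [mem_inf_of_right (mem_principal_self UHP)] with w hw
    exact ne_zero_of_mem_UHP (hf.mapsTo hw).1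
  have hwf : Tendsto (fun w => w * (f w)⁻¹) (cobounded ℂ ⊓ 𝓟 UHP) (𝓝 1) := by
    have := (hf.tendsto.mul hfinv).const_sub 1
    rw [zero_mul, sub_zero] at this
    refine this.congr' ?_
    filter_upwards [hfne] with w hw
    field_simp
    ring
  have hwinv : Tendsto (fun w : ℂ => w⁻¹) (cobounded ℂ ⊓ 𝓟 UHP) (𝓝 0) :=
    tendsto_inv₀_cobounded.mono_left inf_le_left
  have hwW : Tendsto (fun w : ℂ => w / (w - W)) (cobounded ℂ ⊓ 𝓟 UHP) (𝓝 1) := by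
    have := ((hwinv.mul_const (W : ℂ)).const_sub 1).inv₀ (by simp)
    rw [zero_mul, sub_zero, inv_one] at this
    refine this.congr' ?_
    filter_upwards [mem_inf_of_right (mem_principal_self UHP)] with w hw
    have h1 := ne_zero_of_mem_UHP hw
    have h2 := ne_zero_of_mem_UHP (sub_ofReal_mem_UHP hw W)
    field_simp
  have e1 : Tendsto (fun w => -(T / f w ^ 2)) (cobounded ℂ ⊓ 𝓟 UHP) (𝓝 0) := by
    have := ((tendsto_div_sq_cobounded T).comp hfc).neg
    rwa [neg_zero] at this
  have e2 : Tendsto (fun w => w * -(T / f w ^ 2)) (cobounded ℂ ⊓ 𝓟 UHP) (𝓝 0) := by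
    have := (hwf.mul hfinv).const_mul (-T)
    rw [mul_zero, mul_zero] at this
    refine this.congr fun w => ?_
    rw [div_eq_mul_inv, pow_two, mul_inv]
    ring
  have e3 : Tendsto (fun w => w * ((f w - w + W) / (w - W))) (cobounded ℂ ⊓ 𝓟 UHP) (𝓝 W) := by
    have := (hf.tendsto.add_const (W : ℂ)).mul hwW
    rw [zero_add, mul_one] at this
    exact this.congr fun w => by ring
  have e4 : Tendsto (fun w => (f w - w + W) / (w - W)) (cobounded ℂ ⊓ 𝓟 UHP) (𝓝 0) := by
    have := hwinv.mul e3
    rw [zero_mul] at this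
    refine this.congr' ?_
    filter_upwards [mem_inf_of_right (mem_principal_self UHP)] with w hw
    rw [inv_mul_cancel_left₀ (ne_zero_of_mem_UHP hw)]
  have := ((tendsto_mul_log_one_add e1 e2).div_const 2).add (tendsto_mul_log_one_add e4 e3)
  rw [zero_div, zero_add] at this
  refine this.congr' ?_
  filter_upwards [hf.eventually_slitPsi hφ hφ0 W] with w hw
  rw [hw]
  ring

/-- `K` is the preimage in the closed upper half-plane, under squaring, of the part of the graph of
`φ` over `[X₀, ∞)` lying off `ℝ₊`; the graph stays in a cone of slope `k` at its tip `η ^ 2`. -/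
structure IsGraphHull (K : Set ℂ) (φ : ℝ → ℝ) (X₀ k L : ℝ) (η : ℂ) : Prop where
  isCompact : IsCompact K
  continuous : Continuous φ
  eq_zero : ∀ X, 0 ≤ X → φ X = 0
  nonpos : X₀ ≤ 0
  slope_nonneg : 0 ≤ k
  cone : ∀ X, X₀ ≤ X → |φ X - φ X₀| ≤ k * (X - X₀)
  of_mem : ∀ z ∈ K, 0 ≤ z.im ∧ X₀ ≤ (z ^ 2).re ∧ (z ^ 2).im = φ (z ^ 2).re
  mem : ∀ z ∈ UHP, X₀ ≤ (z ^ 2).re → (z ^ 2).im = φ (z ^ 2).re → z ∈ K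
  pos : 0 < L
  norm_le : ∀ z ∈ K, ‖z‖ ≤ L
  tip_mem : η ∈ K
  tip_sq : η ^ 2 = ⟨X₀, φ X₀⟩

section

variable {K : Set ℂ} {φ : ℝ → ℝ} {X₀ k L W : ℝ} {η : ℂ} {g f : ℂ → ℂ}

theorem sq_im' (z : ℂ) : (z ^ 2).im = 2 * z.re * z.im := by
  rw [pow_two, mul_im]; ring

theorem sq_re' (z : ℂ) : (z ^ 2).re = z.re ^ 2 - z.im ^ 2 := by
  rw [pow_two, mul_re]; ring

theorem IsGraphHull.eq_tip (hK : IsGraphHull K φ X₀ k L η) {z : ℂ} (hz : 0 ≤ z.im)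
    (h : z ^ 2 = η ^ 2) : z = η := by
  rcases sq_eq_sq_iff_eq_or_eq_neg.1 h with h | h
  · exact h
  have h1 := (hK.of_mem _ hK.tip_mem).1
  have h2 : z.im = -η.im := by rw [h, neg_im]
  have h3 : η.im = 0 := by linarith
  have h4 : (η ^ 2).re ≤ 0 := by rw [hK.tip_sq]; exact hK.nonpos
  rw [sq_re', h3] at h4
  have h5 : η.re = 0 := by nlinarith
  have : η = 0 := Complex.ext h5 h3
  rw [h, this, neg_zero]

theorem IsGraphHull.differentiableOn (hK : IsGraphHull K φ X₀ k L η)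
    (hf : IsInverseMap K g f) (W : ℝ) : DifferentiableOn ℂ (slitPsi φ X₀ W f) UHP := by
  intro w hw
  refine DifferentiableAt.differentiableWithinAt ?_
  have h1 : DifferentiableAt ℂ f w := hf.differentiableOn.differentiableAt (isOpen_UHP.mem_nhds hw)
  have h2 : DifferentiableAt ℂ (graphLog φ X₀) (f w ^ 2) :=
    differentiableAt_graphLog hK.continuous fun h h' =>
      (hf.mapsTo hw).2 (hK.mem _ (hf.mapsTo hw).1 h h')
  have h3 : DifferentiableAt ℂ (graphLog φ X₀ ∘ fun w => f w ^ 2) w := h2.comp w (h1.fun_pow 2)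
  have h4 : DifferentiableAt ℂ (fun w : ℂ => log (-I * (w - W))) w :=
    DifferentiableAt.clog (by fun_prop)
      (Or.inl (by rw [neg_I_mul_re]; exact sub_ofReal_mem_UHP hw W))
  exact (h3.div_const 2).sub h4

theorem IsGraphHull.exists_tendsto (hK : IsGraphHull K φ X₀ k L η) (hg : IsMappingOut K g)
    (hf : IsInverseMap K g f) (hW : Tendsto g (𝓝[UHP \ K] η) (𝓝 (W : ℂ))) {x : ℝ} (hx : x ≠ W)
    {F : Ultrafilter ℂ} (hFx : (F : Filter ℂ) ≤ 𝓝[UHP] (x : ℂ)) :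
    ∃ z, Tendsto f F (𝓝 z) ∧ (z ∈ K ∨ z.im = 0) ∧ X₀ < (z ^ 2).re ∧ (z ^ 2).im = φ (z ^ 2).re := by
  have hFU : UHP ∈ F := hFx self_mem_nhdsWithin
  have hFx' := hFx.trans nhdsWithin_le_nhds
  obtain ⟨z, hz, hzΩ, hzim⟩ :=
    hf.exists_tendsto_boundary hK.isCompact hg hFx' hFU (by simp [UHP])
  have hzη : z ≠ η := by
    rintro rfl
    have h1 : Tendsto f F (𝓝[UHP \ K] z) :=
      tendsto_nhdsWithin_iff.2 ⟨hz, mem_of_superset hFU fun w hw => hf.mapsTo hw⟩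
    have h2 : Tendsto (fun w => g (f w)) F (𝓝 (W : ℂ)) := hW.comp h1
    have h3 : Tendsto (fun w : ℂ => w) F (𝓝 (W : ℂ)) :=
      h2.congr' (mem_of_superset hFU fun w hw => hf.right_inv w hw)
    have := tendsto_nhds_unique (show Tendsto (fun w : ℂ => w) F (𝓝 (x : ℂ)) from hFx') h3
    exact hx (by exact_mod_cast this)
  have hzK : z ∈ K ∨ z.im = 0 := by
    by_contra! h
    exact hzΩ ⟨lt_of_le_of_ne hzim h.2.symm, h.1⟩
  have hzg : X₀ ≤ (z ^ 2).re ∧ (z ^ 2).im = φ (z ^ 2).re := by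
    rcases hzK with h | h
    · exact (hK.of_mem z h).2
    · have h1 : 0 ≤ (z ^ 2).re := by rw [sq_re', h]; nlinarith [sq_nonneg z.re]
      refine ⟨hK.nonpos.trans h1, ?_⟩
      rw [hK.eq_zero _ h1, sq_im', h, mul_zero]
  refine ⟨z, hz, hzK, lt_of_le_of_ne hzg.1 fun h => hzη (hK.eq_tip hzim ?_), hzg.2⟩
  rw [hK.tip_sq]
  exact Complex.ext h.symm (by rw [hzg.2, ← h])

theorem IsGraphHull.eventually_lt_re (hK : IsGraphHull K φ X₀ k L η) (hg : IsMappingOut K g)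
    (hf : IsInverseMap K g f) (hW : Tendsto g (𝓝[UHP \ K] η) (𝓝 (W : ℂ))) {x : ℝ} (hx : x ≠ W) :
    ∀ᶠ w in 𝓝[UHP] (x : ℂ), X₀ < (f w ^ 2).re := by
  refine mem_iff_ultrafilter.2 fun F hF => ?_
  obtain ⟨z, hz, -, hz1, -⟩ := hK.exists_tendsto hg hf hW hx hF
  exact ((Complex.continuous_re.tendsto _).comp (hz.pow 2)).eventually (lt_mem_nhds hz1)

theorem IsGraphHull.continuousOn_height (hK : IsGraphHull K φ X₀ k L η)
    (hf : IsInverseMap K g f) :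
    ContinuousOn (fun w => (f w ^ 2).im - φ (f w ^ 2).re) UHP := by
  have h1 := hf.differentiableOn.continuousOn.pow 2
  exact (Complex.continuous_im.comp_continuousOn h1).sub
    (hK.continuous.comp_continuousOn (Complex.continuous_re.comp_continuousOn h1))

theorem IsGraphHull.eventually_side (hK : IsGraphHull K φ X₀ k L η) (hg : IsMappingOut K g)
    (hf : IsInverseMap K g f) (hW : Tendsto g (𝓝[UHP \ K] η) (𝓝 (W : ℂ))) {x : ℝ} (hx : x ≠ W) :
    (∀ᶠ w in 𝓝[UHP] (x : ℂ), 0 < (f w ^ 2).im - φ (f w ^ 2).re) ∨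
      ∀ᶠ w in 𝓝[UHP] (x : ℂ), (f w ^ 2).im - φ (f w ^ 2).re < 0 := by
  obtain ⟨r, hr, hrx⟩ := Metric.mem_nhdsWithin_iff.1 (hK.eventually_lt_re hg hf hW hx)
  have hconv : Convex ℝ (Metric.ball (x : ℂ) r ∩ UHP) :=
    (convex_ball _ _).inter (convex_halfSpace_im_gt 0)
  have hmem : Metric.ball (x : ℂ) r ∩ UHP ∈ 𝓝[UHP] (x : ℂ) :=
    inter_mem (mem_nhdsWithin_of_mem_nhds (Metric.ball_mem_nhds _ hr)) self_mem_nhdsWithin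
  have hne : ∀ w ∈ Metric.ball (x : ℂ) r ∩ UHP, (f w ^ 2).im - φ (f w ^ 2).re ≠ 0 :=
    fun w hw h => (hf.mapsTo hw.2).2
      (hK.mem _ (hf.mapsTo hw.2).1 (le_of_lt (hrx hw)) (sub_eq_zero.1 h))
  by_contra! hcon
  obtain ⟨h1, h2⟩ := hcon
  obtain ⟨a, ha, ha'⟩ := (h1.and_eventually hmem).exists
  obtain ⟨b, hb, hb'⟩ := (h2.and_eventually hmem).exists
  obtain ⟨c, hc, hc'⟩ := hconv.isPreconnected.intermediate_value ha' hb'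
    ((hK.continuousOn_height hf).mono inter_subset_right) ⟨ha, hb⟩
  exact hne c hc hc'

theorem neBot_nhdsWithin_UHP (x : ℝ) : (𝓝[UHP] (x : ℂ)).NeBot := by
  rw [← mem_closure_iff_nhdsWithin_neBot, UHP, closure_setOfPred_lt_im]
  simp

theorem IsGraphHull.eventually_sign (hK : IsGraphHull K φ X₀ k L η) (hg : IsMappingOut K g)
    (hf : IsInverseMap K g f) (hW : Tendsto g (𝓝[UHP \ K] η) (𝓝 (W : ℂ))) {σ : ℝ}
    (hσ : σ = 1 ∨ σ = -1) {x : ℝ} (hx : 0 < σ * (x - W)) :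
    ∀ᶠ w in 𝓝[UHP] (x : ℂ), 0 < σ * ((f w ^ 2).im - φ (f w ^ 2).re) := by
  set P : ℂ → ℝ := fun w => (f w ^ 2).im - φ (f w ^ 2).re
  set s : Set ℝ := {x | 0 < σ * (x - W)}
  set U : Set ℝ := {x | ∀ᶠ w in 𝓝[UHP] (x : ℂ), 0 < σ * P w}
  set V : Set ℝ := {x | ∀ᶠ w in 𝓝[UHP] (x : ℂ), σ * P w < 0}
  have hopen : ∀ p : ℂ → Prop, IsOpen {x : ℝ | ∀ᶠ w in 𝓝[UHP] (x : ℂ), p w} := fun p => by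
    refine IsOpen.preimage (t := {x : ℂ | ∀ᶠ w in 𝓝[UHP] x, p w}) Complex.continuous_ofReal ?_
    exact isOpen_iff_mem_nhds.2 fun a ha => eventually_nhds_nhdsWithin.2 ha
  have hUo : IsOpen U := hopen _
  have hVo : IsOpen V := hopen _
  have hsc : IsPreconnected s := by
    rcases hσ with rfl | rfl
    · have : s = Ioi W := by ext; simp [s]
      rw [this]; exact isPreconnected_Ioi
    · have : s = Iio W := by ext; simp [s]
      rw [this]; exact isPreconnected_Iio
  have hUV : Disjoint U V := by
    refine Set.disjoint_left.2 fun y hy hy' => ?_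
    have := neBot_nhdsWithin_UHP y
    have h1 : ∀ᶠ w in 𝓝[UHP] (y : ℂ), 0 < σ * P w := hy
    have h2 : ∀ᶠ w in 𝓝[UHP] (y : ℂ), σ * P w < 0 := hy'
    obtain ⟨w, hw⟩ := (h1.and h2).exists
    exact lt_asymm hw.1 hw.2
  have hcover : s ⊆ U ∪ V := by
    intro y hy
    have hy0 : y ≠ W := by
      rintro rfl
      simp [s] at hy
    rcases hK.eventually_side hg hf hW hy0 with h | h <;> rcases hσ with rfl | rfl
    · exact Or.inl (h.mono fun w hw => by simpa [P] using hw)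
    · exact Or.inr (h.mono fun w hw => by simpa [P] using hw)
    · exact Or.inr (h.mono fun w hw => by simpa [P] using hw)
    · exact Or.inl (h.mono fun w hw => by simpa [P] using hw)
  have hne : (s ∩ U).Nonempty := by
    obtain ⟨M, hM⟩ :=
      eventually_cobounded_inf_principal.1 (hf.tendsto (Metric.ball_mem_nhds 0 one_pos))
    have hσσ : σ * σ = 1 := by rcases hσ with rfl | rfl <;> norm_num
    have hσa : |σ| = 1 := by rcases hσ with rfl | rfl <;> norm_num
    have hM0 := le_max_right M 0
    have hM1 := le_max_left M 0
    refine ⟨σ * (max M 0 + |W| + 5), ?_, ?_⟩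
    · have h1 : σ * W ≤ |W| := by
        have := le_abs_self (σ * W)
        rwa [abs_mul, hσa, one_mul] at this
      change 0 < σ * (_ - W)
      have : σ * (σ * (max M 0 + |W| + 5) - W) = max M 0 + |W| + 5 - σ * W := by
        linear_combination (max M 0 + |W| + 5) * hσσ
      rw [this]
      linarith
    · change ∀ᶠ w in 𝓝[UHP] _, 0 < σ * P w
      filter_upwards [mem_nhdsWithin_of_mem_nhds (Metric.ball_mem_nhds _ one_pos),
        self_mem_nhdsWithin] with w hw hwU
      rw [Metric.mem_ball, dist_eq_norm] at hw
      have h1 := (abs_re_le_norm _).trans hw.le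
      have h2 := (abs_im_le_norm _).trans hw.le
      simp only [sub_re, sub_im, ofReal_re, ofReal_im, sub_zero] at h1 h2
      have h3 : max M 0 + |W| + 4 ≤ σ * w.re := by
        have h4 : |σ * (w.re - σ * (max M 0 + |W| + 5))| ≤ 1 := by rwa [abs_mul, hσa, one_mul]
        have h5 := (abs_le.1 h4).1
        have : σ * (w.re - σ * (max M 0 + |W| + 5)) = σ * w.re - (max M 0 + |W| + 5) := by
          linear_combination -(max M 0 + |W| + 5) * hσσ
        linarith
      have h4 : M < ‖w‖ := by
        have h5 := le_abs_self (σ * w.re)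
        rw [abs_mul, hσa, one_mul] at h5
        have := abs_re_le_norm w
        have := abs_nonneg W
        linarith
      have h5 := hM w hwU h4
      rw [mem_ball_zero_iff] at h5
      have h6 := (abs_re_le_norm _).trans h5.le
      have h7 := (abs_im_le_norm _).trans h5.le
      rw [sub_re] at h6
      rw [sub_im] at h7
      have h8 : 3 ≤ σ * (f w).re := by
        have h9 : |σ * ((f w).re - w.re)| ≤ 1 := by rwa [abs_mul, hσa, one_mul]
        have := (abs_le.1 h9).1
        have := abs_nonneg W
        linarith
      have h9 : (f w).im ≤ 2 := by linarith [(abs_le.1 h2).2, (abs_le.1 h7).2]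
      have h10 : 0 < (f w).im := (hf.mapsTo hwU).1
      have h11 : 0 ≤ (f w ^ 2).re := by
        have : (f w).re ^ 2 = (σ * (f w).re) ^ 2 := by linear_combination -(f w).re ^ 2 * hσσ
        rw [sq_re', this]
        nlinarith
      simp only [P, hK.eq_zero _ h11, sq_im', sub_zero]
      nlinarith
  exact hsc.subset_left_of_subset_union hUo hVo hUV hcover hne hx

end

theorem abs_arg_le_abs_im_div_re {z : ℂ} (hz : 0 < z.re) : |arg z| ≤ |z.im| / z.re := by
  have h := abs_lt.1 (abs_arg_lt_pi_div_two_iff.2 (Or.inl hz))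
  rw [← abs_of_pos hz, ← abs_div, ← tan_arg]
  rcases le_total 0 (arg z) with h0 | h0
  · rw [abs_of_nonneg h0]
    exact (Real.le_tan h0 h.2).trans (le_abs_self _)
  · rw [abs_of_nonpos h0]
    refine (Real.le_tan (neg_nonneg.2 h0) (by linarith [h.1])).trans ?_
    rw [Real.tan_neg]
    exact neg_le_abs _

section

variable {K : Set ℂ} {φ : ℝ → ℝ} {X₀ k L W : ℝ} {η : ℂ} {g f : ℂ → ℂ}

theorem barrier_re (A L : ℝ) (z : ℂ) :
    (A * I / (z + L * I)).re = A * (z.im + L) / (z.re ^ 2 + (z.im + L) ^ 2) := by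
  rw [div_re, normSq_apply]
  simp
  ring

theorem IsGraphHull.abs_arg_le (hK : IsGraphHull K φ X₀ k L η) {z : ℂ} (hz : z ∈ K ∨ z.im = 0)
    (h1 : X₀ < (z ^ 2).re) (h2 : (z ^ 2).im = φ (z ^ 2).re) :
    |arg (z ^ 2 - (⟨X₀, φ X₀⟩ : ℂ))| / 2 ≤ ((2 * k * L : ℝ) * I / (z + L * I)).re := by
  have hL := hK.pos
  have hk := hK.slope_nonneg
  have hre : 0 < (z ^ 2 - (⟨X₀, φ X₀⟩ : ℂ)).re := by simpa using h1
  have ha := abs_arg_le_abs_im_div_re hre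
  rw [sub_im, sub_re, h2] at ha
  rw [barrier_re]
  simp only at ha
  rcases hz with hz | hz
  · have h3 : |φ (z ^ 2).re - φ X₀| / ((z ^ 2).re - X₀) ≤ k := by
      rw [div_le_iff₀ (by linarith)]
      exact hK.cone _ h1.le
    have hy := (hK.of_mem z hz).1
    have h4 : z.re ^ 2 + z.im ^ 2 ≤ L ^ 2 := by
      have := hK.norm_le z hz
      have h5 : ‖z‖ ^ 2 ≤ L ^ 2 := pow_le_pow_left₀ (norm_nonneg _) this 2
      rw [Complex.sq_norm, normSq_apply] at h5
      linarith
    have h6 : k / 2 ≤ 2 * k * L * (z.im + L) / (z.re ^ 2 + (z.im + L) ^ 2) := by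
      rw [le_div_iff₀ (by positivity)]
      have h7 : z.im ≤ L := by nlinarith
      have h8 : z.re ^ 2 + (z.im + L) ^ 2 ≤ 4 * L * (z.im + L) := by nlinarith
      nlinarith
    linarith
  · have h3 : (z ^ 2).re = z.re ^ 2 := by rw [sq_re', hz]; ring
    have h4 : φ (z ^ 2).re = 0 := hK.eq_zero _ (by rw [h3]; positivity)
    have h5 : |φ X₀| ≤ k * (-X₀) := by
      have := hK.cone 0 hK.nonpos
      rwa [hK.eq_zero 0 le_rfl, zero_sub, zero_sub, abs_neg] at this
    have h6 : -X₀ ≤ L ^ 2 := by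
      have h7 : ‖η ^ 2‖ ≤ L ^ 2 := by
        rw [norm_pow]
        exact pow_le_pow_left₀ (norm_nonneg _) (hK.norm_le η hK.tip_mem) 2
      have h8 := (neg_le_abs _).trans (abs_re_le_norm (η ^ 2))
      rw [hK.tip_sq] at h8 h7
      exact h8.trans h7
    rw [h4, zero_sub, abs_neg] at ha
    have h7 : |φ X₀| / ((z ^ 2).re - X₀) ≤ k * (-X₀) / ((z ^ 2).re - X₀) := by
      gcongr
    have h8 : k * (-X₀) / ((z ^ 2).re - X₀) ≤ 4 * k * L ^ 2 / (z.re ^ 2 + L ^ 2) := by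
      rw [h3] at h1 ⊢
      rw [div_le_div_iff₀ (by linarith) (by positivity)]
      have e1 : k * (-X₀) * (z.re ^ 2 + L ^ 2) ≤ k * (L ^ 2 * (z.re ^ 2 - X₀)) := by
        rw [mul_assoc]
        refine mul_le_mul_of_nonneg_left ?_ hk
        nlinarith [sq_nonneg z.re]
      have e2 : 0 ≤ k * (L ^ 2 * (z.re ^ 2 - X₀)) := by
        have : 0 ≤ z.re ^ 2 - X₀ := by linarith
        positivity
      nlinarith
    have h9 : 2 * k * L * (z.im + L) / (z.re ^ 2 + (z.im + L) ^ 2) =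
        (4 * k * L ^ 2 / (z.re ^ 2 + L ^ 2)) / 2 := by
      rw [hz, zero_add]; ring
    rw [h9]
    linarith

theorem arg_neg_I_mul_ofReal {x : ℝ} {σ : ℝ} (hσ : σ = 1 ∨ σ = -1) (hx : 0 < σ * x) :
    arg (-I * x) = -(σ * (Real.pi / 2)) := by
  rcases hσ with rfl | rfl
  · rw [mul_comm, arg_real_mul _ (by linarith), arg_neg_I]
    ring
  · have : -I * (x : ℂ) = ((-x : ℝ) : ℂ) * I := by push_cast; ring
    rw [this, arg_real_mul _ (by linarith), arg_I]
    ring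

theorem graphLog_im_of_sign {z : ℂ} {σ : ℝ} (hσ : σ = 1 ∨ σ = -1) (hz : X₀ < z.re)
    (h : 0 < σ * (z.im - φ z.re)) :
    (graphLog φ X₀ z).im = arg (z - (⟨X₀, φ X₀⟩ : ℂ)) - σ * Real.pi := by
  rcases hσ with rfl | rfl
  · rw [graphLog_of_above hz (by linarith)]
    simp [log_im]
  · rw [graphLog_of_below hz (by linarith)]
    simp [log_im]

theorem IsGraphHull.tendsto_im (hK : IsGraphHull K φ X₀ k L η) (hg : IsMappingOut K g)
    (hf : IsInverseMap K g f) (hW : Tendsto g (𝓝[UHP \ K] η) (𝓝 (W : ℂ))) {x : ℝ} (hx : x ≠ W)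
    {F : Ultrafilter ℂ} (hFx : (F : Filter ℂ) ≤ 𝓝[UHP] (x : ℂ)) :
    ∃ z, Tendsto f F (𝓝 z) ∧ 0 ≤ z.im ∧
      Tendsto (fun w => (slitPsi φ X₀ W f w).im) F (𝓝 (arg (z ^ 2 - (⟨X₀, φ X₀⟩ : ℂ)) / 2)) ∧
      |arg (z ^ 2 - (⟨X₀, φ X₀⟩ : ℂ))| / 2 ≤ ((2 * k * L : ℝ) * I / (z + L * I)).re := by
  obtain ⟨z, hz, hzK, hz1, hz2⟩ := hK.exists_tendsto hg hf hW hx hFx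
  have hzim : 0 ≤ z.im := by
    rcases hzK with h | h
    · exact (hK.of_mem z h).1
    · exact h.ge
  refine ⟨z, hz, hzim, ?_, hK.abs_arg_le hzK hz1 hz2⟩
  obtain ⟨σ, hσ, hσx⟩ : ∃ σ : ℝ, (σ = 1 ∨ σ = -1) ∧ 0 < σ * (x - W) := by
    rcases hx.lt_or_gt with h | h
    · exact ⟨-1, Or.inr rfl, by linarith⟩
    · exact ⟨1, Or.inl rfl, by linarith⟩
  set T : ℂ := ⟨X₀, φ X₀⟩ with hT
  have e1 : Tendsto (fun w => arg (f w ^ 2 - T)) F (𝓝 (arg (z ^ 2 - T))) := by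
    have hslit : z ^ 2 - T ∈ slitPlane := Or.inl (by simpa [hT] using hz1)
    exact (continuousAt_arg hslit).tendsto.comp ((hz.pow 2).sub_const T)
  have e2 : Tendsto (fun w : ℂ => arg (-I * (w - W))) F (𝓝 (-(σ * (Real.pi / 2)))) := by
    rw [← arg_neg_I_mul_ofReal hσ hσx]
    have hslit : -I * ((x - W : ℝ) : ℂ) ∈ slitPlane := by
      refine Or.inr ?_
      rw [neg_I_mul_im, ofReal_re]
      exact neg_ne_zero.2 (sub_ne_zero.2 hx)
    have h3 : Tendsto (fun w : ℂ => -I * (w - W)) F (𝓝 (-I * ((x - W : ℝ) : ℂ))) := by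
      rw [ofReal_sub]
      have : Tendsto (fun w : ℂ => w) F (𝓝 (x : ℂ)) := hFx.trans nhdsWithin_le_nhds
      exact (this.sub_const _).const_mul _
    exact (continuousAt_arg hslit).tendsto.comp h3
  have e3 := ((e1.sub_const (σ * Real.pi)).div_const 2).sub e2
  have e4 : (arg (z ^ 2 - T) - σ * Real.pi) / 2 - -(σ * (Real.pi / 2)) = arg (z ^ 2 - T) / 2 := by
    ring
  rw [e4] at e3
  refine e3.congr' ?_
  filter_upwards [hFx (hK.eventually_lt_re hg hf hW hx),
    hFx (hK.eventually_sign hg hf hW hσ hσx)] with w hw1 hw2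
  rw [slitPsi, sub_im, log_im, div_ofNat_im, graphLog_im_of_sign hσ hw1 hw2]

theorem div_add_I_re_pos {u : ℂ} (hu : u ∈ UHP) : 0 < (u / (u + I)).re := by
  have h : 0 < u.im := hu
  have h2 : 0 < normSq (u + I) := by
    rw [normSq_apply]
    simp only [add_re, I_re, add_im, I_im]
    nlinarith [mul_self_nonneg (u.re + 0)]
  have h3 : (u / (u + I)).re = (u.re * u.re + u.im * (u.im + 1)) / normSq (u + I) := by
    rw [div_re]
    simp
    ring
  rw [h3]
  apply div_pos _ h2
  nlinarith [mul_self_nonneg u.re]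

theorem norm_div_add_I_lt_one {u : ℂ} (hu : u ∈ UHP) : ‖u / (u + I)‖ < 1 := by
  have h : 0 < u.im := hu
  have h0 : 0 < ‖u + I‖ := norm_pos_iff.2 fun h' => by
    have := congrArg Complex.im h'
    simp at this
    linarith
  rw [norm_div, div_lt_one h0]
  refine lt_of_pow_lt_pow_left₀ 2 h0.le ?_
  rw [Complex.sq_norm, Complex.sq_norm, normSq_apply, normSq_apply]
  simp only [add_re, I_re, add_im, I_im]
  nlinarith

theorem add_mul_I_ne_zero {z : ℂ} (hz : 0 ≤ z.im) (hL : 0 < L) : z + L * I ≠ 0 := fun h => by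
  have := congrArg Complex.im h
  simp at this
  linarith

theorem abs_slitPsi_im_le {w : ℂ} (hw : w ∈ UHP) :
    |(slitPsi φ X₀ W f w).im| ≤ 2 * Real.pi := by
  have h1 := abs_le.1 (abs_graphLog_im_le (φ := φ) (X₀ := X₀) (z := f w ^ 2))
  have h2 := abs_lt.1 (abs_arg_neg_I_mul_lt (sub_ofReal_mem_UHP hw W))
  rw [slitPsi, sub_im, div_ofNat_im, log_im, abs_le]
  constructor <;> linarith [h1.1, h1.2, h2.1, h2.2, Real.pi_pos]

theorem IsGraphHull.barrier_nonneg (hK : IsGraphHull K φ X₀ k L η) {z : ℂ} (hz : 0 ≤ z.im) :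
    0 ≤ ((2 * k * L : ℝ) * I / (z + L * I)).re := by
  have := hK.pos
  have := hK.slope_nonneg
  rw [barrier_re]
  positivity

theorem IsGraphHull.tendsto_barrier (hK : IsGraphHull K φ X₀ k L η) {F : Filter ℂ} {z : ℂ}
    (hz : 0 ≤ z.im) (hf : Tendsto f F (𝓝 z)) :
    Tendsto (fun w => ((2 * k * L : ℝ) * I / (f w + L * I)).re) F
      (𝓝 ((2 * k * L : ℝ) * I / (z + L * I)).re) :=
  (Complex.continuous_re.tendsto _).comp
    (tendsto_const_nhds.div (hf.add_const _) (add_mul_I_ne_zero hz hK.pos))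

theorem IsInverseMap.tendsto_barrier_zero (hf : IsInverseMap K g f) (k L : ℝ) :
    Tendsto (fun w => ((2 * k * L : ℝ) * I / (f w + L * I)).re) (cobounded ℂ ⊓ 𝓟 UHP) (𝓝 0) := by
  have h1 : Tendsto (fun w => f w + L * I) (cobounded ℂ ⊓ 𝓟 UHP) (cobounded ℂ) := by
    have h2 := tendsto_norm_cobounded_atTop.comp (hf.tendsto_cobounded.mono_right inf_le_left)
    rw [← tendsto_norm_atTop_iff_cobounded]
    refine tendsto_atTop_mono (fun w => ?_) (tendsto_atTop_add_const_right _ (-‖L * I‖) h2)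
    have := norm_sub_le (f w + L * I) (L * I)
    rw [add_sub_cancel_right] at this
    simp only [Function.comp_apply]
    linarith
  have h2 := (tendsto_inv₀_cobounded.comp h1).const_mul ((2 * k * L : ℝ) * I)
  rw [mul_zero] at h2
  have := (Complex.continuous_re.tendsto _).comp h2
  rw [zero_re] at this
  exact this.congr fun w => by simp [div_eq_mul_inv]

theorem IsGraphHull.tendsto_slitPsi_zero (hK : IsGraphHull K φ X₀ k L η)
    (hf : IsInverseMap K g f) (W : ℝ) :
    Tendsto (slitPsi φ X₀ W f) (cobounded ℂ ⊓ 𝓟 UHP) (𝓝 0) := by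
  have h := (tendsto_inv₀_cobounded.mono_left inf_le_left).mul
    (hf.tendsto_mul_slitPsi (X₀ := X₀) hK.continuous hK.eq_zero W)
  rw [zero_mul] at h
  refine h.congr' ?_
  filter_upwards [mem_inf_of_right (mem_principal_self UHP)] with w hw
  rw [inv_mul_cancel_left₀ (ne_zero_of_mem_UHP hw)]

theorem IsGraphHull.lt_of_pos (hK : IsGraphHull K φ X₀ k L η) (hg : IsMappingOut K g)
    (hf : IsInverseMap K g f) (hW : Tendsto g (𝓝[UHP \ K] η) (𝓝 (W : ℂ))) {σ : ℝ}
    (hσ : |σ| = 1) {δ c : ℝ} (hδ : 0 < δ) (hc : 0 < c) {w : ℂ} (hw : w ∈ UHP) :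
    σ * (slitPsi φ X₀ W f w).im - ((2 * k * L : ℝ) * I / (f w + L * I)).re +
      δ * Real.log ‖(w - W) / (w - W + I)‖ < c := by
  set F : ℂ → ℂ := fun w => -(σ * I * slitPsi φ X₀ W f w) - (2 * k * L : ℝ) * I / (f w + L * I) +
      δ * log ((w - W) / (w - W + I)) with hFdef
  have hFre : ∀ w, (F w).re = σ * (slitPsi φ X₀ W f w).im -
      ((2 * k * L : ℝ) * I / (f w + L * I)).re + δ * Real.log ‖(w - W) / (w - W + I)‖ := by
    intro w
    simp only [hFdef, add_re, sub_re, re_ofReal_mul, log_re, neg_re, mul_assoc, I_mul_re]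
    ring
  have hfim : ∀ w ∈ UHP, 0 ≤ (f w).im := fun w hw => le_of_lt (hf.mapsTo hw).1
  have hFd : DifferentiableOn ℂ F UHP := by
    refine (((hK.differentiableOn hf W).const_mul _).neg.sub ?_).add ?_
    · exact (differentiableOn_const _).div (hf.differentiableOn.add_const _)
        fun w hw => add_mul_I_ne_zero (hfim w hw) hK.pos
    · refine DifferentiableOn.const_mul (DifferentiableOn.clog ?_ fun w hw =>
        Or.inl (div_add_I_re_pos (sub_ofReal_mem_UHP hw W))) _
      refine DifferentiableOn.div (by fun_prop) (by fun_prop) fun w hw => ?_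
      have := add_mul_I_ne_zero (le_of_lt (sub_ofReal_mem_UHP hw W)) one_pos
      simpa using this
  have hlog : ∀ w ∈ UHP, δ * Real.log ‖(w - W) / (w - W + I)‖ ≤ 0 := fun w hw =>
    mul_nonpos_of_nonneg_of_nonpos hδ.le (Real.log_nonpos (norm_nonneg _)
      (norm_div_add_I_lt_one (sub_ofReal_mem_UHP hw W)).le)
  rw [← hFre]
  refine re_lt_of_isCompact_superlevel isOpen_UHP hFd ?_ w hw
  rw [isCompact_iff_ultrafilter_le_nhds]
  intro G hG
  rw [le_principal_iff] at hG
  have hGU : UHP ∈ G := mem_of_superset hG fun w hw => hw.1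
  have hGc : ∀ᶠ w in (G : Filter ℂ), c ≤ (F w).re := mem_of_superset hG fun w hw => hw.2
  have hbdd : ∃ M, ∀ w ∈ UHP, M < ‖w‖ → (F w).re < c := by
    rw [← eventually_cobounded_inf_principal]
    have h1 := ((((Complex.continuous_im.tendsto _).comp
      (hK.tendsto_slitPsi_zero hf W)).const_mul σ).sub
      (hf.tendsto_barrier_zero k L)).eventually
      (gt_mem_nhds (show σ * (0 : ℂ).im - 0 < c by simpa using hc))
    filter_upwards [h1, mem_inf_of_right (mem_principal_self UHP)] with w hw hwU
    rw [hFre]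
    have := hlog w hwU
    simp only [Function.comp_apply] at hw
    linarith
  obtain ⟨M, hM⟩ := hbdd
  have hGM : (G : Filter ℂ) ≤ 𝓟 (Metric.closedBall 0 M) := by
    rw [le_principal_iff]
    filter_upwards [hGU, hGc] with w hw hwc
    rw [mem_closedBall_zero_iff]
    by_contra! h
    exact (hM w hw h).not_ge hwc
  obtain ⟨p, -, hp⟩ := isCompact_iff_ultrafilter_le_nhds.1 (isCompact_closedBall (0 : ℂ) M) _ hGM
  have hid : Tendsto (fun w : ℂ => w) G (𝓝 p) := hp
  have hpim : 0 ≤ p.im := ge_of_tendsto ((Complex.continuous_im.tendsto p).comp hid)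
    (mem_of_superset hGU fun w hw => show 0 ≤ w.im from le_of_lt hw)
  rcases hpim.lt_or_eq with hpos | h0
  · refine ⟨p, ⟨hpos, ?_⟩, hp⟩
    have hFp := (hFd.differentiableAt (isOpen_UHP.mem_nhds hpos)).continuousAt
    exact ge_of_tendsto ((Complex.continuous_re.tendsto _).comp (hFp.tendsto.comp hid)) hGc
  exfalso
  obtain ⟨x, rfl⟩ : ∃ x : ℝ, p = x := ⟨p.re, Complex.ext (by simp) (by simp [← h0])⟩
  have hGx : (G : Filter ℂ) ≤ 𝓝[UHP] (x : ℂ) := le_inf hp (le_principal_iff.2 hGU)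
  rcases eq_or_ne x W with rfl | hx
  · have h1 : Tendsto (fun w : ℂ => ‖(w - x) / (w - x + I)‖) G (𝓝[>] 0) := by
      refine tendsto_nhdsWithin_iff.2 ⟨?_, ?_⟩
      · have h2 := hid.sub_const (x : ℂ)
        have h3 := (h2.div (h2.add_const I) (by simp)).norm
        simpa using h3
      · refine mem_of_superset hGU fun w hw => ?_
        refine norm_pos_iff.2 fun h => ?_
        have := div_add_I_re_pos (sub_ofReal_mem_UHP hw x)
        rw [h, zero_re] at this
        exact lt_irrefl _ this
    have h2 : Tendsto (fun w : ℂ => δ * Real.log ‖(w - x) / (w - x + I)‖) G atBot :=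
      (Real.tendsto_log_nhdsGT_zero.comp h1).const_mul_atBot hδ
    obtain ⟨w, ⟨hw1, hw2⟩, hw3⟩ :=
      ((h2.eventually (eventually_lt_atBot (-(2 * Real.pi)))).and hGU |>.and hGc).exists
    rw [hFre] at hw3
    have h3 := (le_abs_self _).trans
      ((abs_mul σ _).trans_le (by rw [hσ, one_mul]; exact abs_slitPsi_im_le hw2) :
        |σ * (slitPsi φ X₀ x f w).im| ≤ 2 * Real.pi)
    have h4 := hK.barrier_nonneg (hfim w hw2)
    linarith
  · obtain ⟨z, hz, hzim, hzt, hzb⟩ := hK.tendsto_im hg hf hW hx hGx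
    have h1 := (hzt.const_mul σ).sub (hK.tendsto_barrier hzim hz)
    have h2 := ge_of_tendsto h1 (show ∀ᶠ w in (G : Filter ℂ), c ≤ σ * (slitPsi φ X₀ W f w).im -
        ((2 * k * L : ℝ) * I / (f w + L * I)).re by
      filter_upwards [hGc, hGU] with w hw hwU
      rw [hFre] at hw
      have := hlog w hwU
      linarith)
    have h3 := le_abs_self (σ * (arg (z ^ 2 - (⟨X₀, φ X₀⟩ : ℂ)) / 2))
    rw [abs_mul, hσ, one_mul, abs_div, abs_two] at h3
    linarith

theorem IsGraphHull.abs_le (hK : IsGraphHull K φ X₀ k L η) (hg : IsMappingOut K g)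
    (hW : Tendsto g (𝓝[UHP \ K] η) (𝓝 (W : ℂ))) : |W| ≤ 2 * k * L := by
  obtain ⟨f, hf⟩ := hg.exists_inverse hK.isCompact
  have key : ∀ σ : ℝ, |σ| = 1 → ∀ w ∈ UHP, σ * (slitPsi φ X₀ W f w).im ≤
      ((2 * k * L : ℝ) * I / (f w + L * I)).re := by
    intro σ hσ w hw
    refine le_of_forall_pos_le_add fun c hc => ?_
    have h1 : Tendsto (fun δ : ℝ => σ * (slitPsi φ X₀ W f w).im -
        ((2 * k * L : ℝ) * I / (f w + L * I)).re + δ * Real.log ‖(w - W) / (w - W + I)‖) (𝓝[>] 0)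
        (𝓝 (σ * (slitPsi φ X₀ W f w).im - ((2 * k * L : ℝ) * I / (f w + L * I)).re +
          0 * Real.log ‖(w - W) / (w - W + I)‖)) :=
      (((continuous_id.mul continuous_const).const_add _).tendsto 0).mono_left nhdsWithin_le_nhds
    have := le_of_tendsto h1 (by
      filter_upwards [self_mem_nhdsWithin] with δ hδ
      exact (hK.lt_of_pos hg hf hW hσ hδ hc hw).le)
    linarith
  have h1 : Tendsto (fun Y : ℝ => Y * (slitPsi φ X₀ W f (Y * I)).im) atTop (𝓝 (-W)) := by
    have := ((Complex.continuous_re.tendsto _).comp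
      ((hf.tendsto_mul_slitPsi (X₀ := X₀) hK.continuous hK.eq_zero W).comp tendsto_ofReal_mul_I)).neg
    rw [ofReal_re] at this
    refine this.congr fun Y => ?_
    simp [mul_assoc]
  have h2 : Tendsto (fun Y : ℝ => Y * ((2 * k * L : ℝ) * I / (f (Y * I) + L * I)).re) atTop
      (𝓝 (2 * k * L)) := by
    have e1 : Tendsto (fun Y : ℝ => ((Y⁻¹ : ℝ) : ℂ)) atTop (𝓝 ((0 : ℝ) : ℂ)) :=
      (Complex.continuous_ofReal.tendsto 0).comp tendsto_inv_atTop_zero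
    have e2 := ((((hf.tendsto_imaginary.add_const (L * I)).mul e1).add_const I).inv₀
      (by simp)).const_mul ((2 * k * L : ℝ) * I)
    have e3 := (Complex.continuous_re.tendsto _).comp e2
    have e4 : (((2 * k * L : ℝ) : ℂ) * I * ((0 + L * I) * ((0 : ℝ) : ℂ) + I)⁻¹).re =
        2 * k * L := by
      rw [ofReal_zero, mul_zero, zero_add, mul_assoc, mul_inv_cancel₀ I_ne_zero, mul_one,
        ofReal_re]
    rw [e4] at e3
    refine e3.congr' ?_
    filter_upwards [eventually_gt_atTop 0] with Y hY
    have hY' : (Y : ℂ) ≠ 0 := by exact_mod_cast hY.ne'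
    have e5 : (f (Y * I) - Y * I + L * I) * ((Y⁻¹ : ℝ) : ℂ) + I = (f (Y * I) + L * I) / Y := by
      push_cast
      field_simp
      ring
    simp only [Function.comp_apply]
    rw [e5, inv_div, ← re_ofReal_mul]
    congr 1
    ring
  have hev : ∀ σ : ℝ, |σ| = 1 → σ * -W ≤ 2 * k * L := by
    intro σ hσ
    refine le_of_tendsto_of_tendsto (h1.const_mul σ) h2 ?_
    filter_upwards [eventually_gt_atTop 0] with Y hY
    have hYU : (Y : ℂ) * I ∈ UHP := by simpa [UHP] using hY
    have := mul_le_mul_of_nonneg_left (key σ hσ _ hYU) hY.le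
    linarith
  rw [_root_.abs_le]
  constructor
  · linarith [hev 1 (by simp)]
  · linarith [hev (-1) (by simp)]

end

theorem sqrtH_sq (z : ℂ) : sqrtH z ^ 2 = z := by
  have := cpow_nat_inv_pow (-z) two_ne_zero
  rw [sqrtH, mul_pow, I_sq, one_div]
  push_cast at this
  rw [this]
  ring

theorem sqrtH_im_nonneg (z : ℂ) : 0 ≤ (sqrtH z).im := by
  rw [sqrtH, I_mul_im]
  rcases eq_or_ne (-z) 0 with h | h
  · rw [h, zero_cpow (by norm_num)]
    simp
  rw [cpow_def_of_ne_zero h, exp_re]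
  refine mul_nonneg (Real.exp_pos _).le (Real.cos_nonneg_of_mem_Icc ?_)
  have h1 : (log (-z) * (1 / 2)).im = arg (-z) / 2 := by
    rw [mul_one_div, div_ofNat_im, log_im]
  rw [h1]
  have := neg_pi_lt_arg (-z)
  have := arg_le_pi (-z)
  constructor <;> linarith

theorem eq_sqrtH_of_mem_UHP {z q : ℂ} (hz : z ∈ UHP) (h : z ^ 2 = q) : z = sqrtH q := by
  rw [← sqrtH_sq q] at h
  rcases sq_eq_sq_iff_eq_or_eq_neg.1 h with h | h
  · exact h
  · have h1 : 0 < z.im := hz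
    have h2 := sqrtH_im_nonneg q
    rw [h, neg_im] at h1
    linarith

theorem norm_sqrtH_sq (z : ℂ) : ‖sqrtH z‖ ^ 2 = ‖z‖ := by
  rw [← norm_pow, sqrtH_sq]

theorem neg_re_le_sqrtH_im_sq (z : ℂ) : -z.re ≤ (sqrtH z).im ^ 2 := by
  have := sq_re' (sqrtH z)
  rw [sqrtH_sq] at this
  nlinarith [sq_nonneg (sqrtH z).re]

theorem isCompact_sqrtH_image {γ : ℝ → ℂ} {s : ℝ} (hγ : ContinuousOn γ (Icc 0 s))
    (h : ∀ u ∈ Icc 0 s, (γ u).re ≤ 0 ∨ (γ u).im ≠ 0) :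
    IsCompact ((fun u => sqrtH (γ u)) '' Icc 0 s) := by
  refine isCompact_Icc.image_of_continuousOn (continuousOn_const.mul fun u hu => ?_)
  have h1 : ContinuousAt (fun z : ℂ => z ^ ((1 : ℂ) / 2)) (-γ u) :=
    continuousAt_cpow_const_of_re_pos (by simpa using h u hu) (by norm_num)
  exact ContinuousAt.comp_continuousWithinAt (f := fun u => -γ u) h1 (hγ u hu).neg

section

variable {γ γ' : ℝ → ℂ} {s ε : ℝ}

theorem norm_sub_add_le
    (hd : ∀ u ∈ Icc 0 s, HasDerivWithinAt γ (γ' u) (Icc 0 s) u)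
    (hε : ∀ u ∈ Icc 0 s, ‖γ' u + 1‖ ≤ ε) {u v : ℝ} (hu : u ∈ Icc 0 s) (hv : v ∈ Icc 0 s) :
    ‖γ v - γ u + (v - u : ℝ)‖ ≤ ε * |v - u| := by
  have h1 : ∀ u ∈ Icc 0 s, HasDerivWithinAt (fun u => γ u + (u : ℂ)) (γ' u + 1) (Icc 0 s) u :=
    fun u hu => (hd u hu).add (Complex.ofRealCLM.hasDerivWithinAt)
  have := (convex_Icc 0 s).norm_image_sub_le_of_norm_hasDerivWithin_le h1 hε hu hv
  rw [Real.norm_eq_abs] at this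
  have e : γ v - γ u + (v - u : ℝ) = (γ v + v) - (γ u + u) := by
    push_cast
    ring
  rwa [e]

theorem abs_im_sub_le
    (hd : ∀ u ∈ Icc 0 s, HasDerivWithinAt γ (γ' u) (Icc 0 s) u)
    (hε : ∀ u ∈ Icc 0 s, ‖γ' u + 1‖ ≤ ε) {u v : ℝ} (hu : u ∈ Icc 0 s) (hv : v ∈ Icc 0 s) :
    |(γ v).im - (γ u).im| ≤ ε * |v - u| := by
  have := (abs_im_le_norm _).trans (norm_sub_add_le hd hε hu hv)
  simpa using this

theorem le_re_sub
    (hd : ∀ u ∈ Icc 0 s, HasDerivWithinAt γ (γ' u) (Icc 0 s) u)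
    (hε : ∀ u ∈ Icc 0 s, ‖γ' u + 1‖ ≤ ε) (hε1 : ε ≤ 2 / 5) {u v : ℝ} (hu : u ∈ Icc 0 s)
    (hv : v ∈ Icc 0 s) (huv : u ≤ v) :
    3 / 5 * (v - u) ≤ (γ u).re - (γ v).re := by
  have := (abs_re_le_norm _).trans (norm_sub_add_le hd hε hu hv)
  simp only [add_re, sub_re, ofReal_re] at this
  rw [abs_of_nonneg (sub_nonneg.2 huv)] at this
  have h1 := (abs_le.1 this).2
  nlinarith

/-- A point of the curve `γ [0, s] ∪ ℝ₊`. -/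
def OnExtended (γ : ℝ → ℂ) (s : ℝ) (z : ℂ) : Prop :=
  (0 ≤ z.re ∧ z.im = 0) ∨ ∃ u ∈ Icc 0 s, γ u = z

theorem OnExtended.abs_im_sub_le
    (hd : ∀ u ∈ Icc 0 s, HasDerivWithinAt γ (γ' u) (Icc 0 s) u)
    (hε : ∀ u ∈ Icc 0 s, ‖γ' u + 1‖ ≤ ε) (hε1 : ε ≤ 2 / 5) (hs : 0 ≤ s) (h0 : γ 0 = 0)
    {z w : ℂ} (hz : OnExtended γ s z) (hw : OnExtended γ s w) :
    |z.im - w.im| ≤ 5 / 3 * ε * |z.re - w.re| := by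
  have hε0 : 0 ≤ ε := (norm_nonneg _).trans (hε 0 ⟨le_rfl, hs⟩)
  have hcurve : ∀ u ∈ Icc 0 s, ∀ v ∈ Icc 0 s, u ≤ v →
      |(γ v).im - (γ u).im| ≤ 5 / 3 * ε * |(γ v).re - (γ u).re| := by
    intro u hu v hv huv
    have h1 := _root_.abs_im_sub_le hd hε hu hv
    have h2 := le_re_sub hd hε hε1 hu hv huv
    have h3 := neg_le_abs ((γ v).re - (γ u).re)
    rw [abs_of_nonneg (sub_nonneg.2 huv)] at h1
    calc _ ≤ _ := h1
      _ = 5 / 3 * ε * (3 / 5 * (v - u)) := by ring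
      _ ≤ _ := by
        gcongr
        linarith
  have hmixed : ∀ z w : ℂ, 0 ≤ z.re → z.im = 0 → ∀ u ∈ Icc 0 s, γ u = w →
      |w.im - z.im| ≤ 5 / 3 * ε * |w.re - z.re| := by
    rintro z w hz hz' u hu rfl
    have h1 := hcurve 0 ⟨le_rfl, hs⟩ u hu hu.1
    have h2 := le_re_sub hd hε hε1 ⟨le_rfl, hs⟩ hu hu.1
    rw [h0, zero_re] at h2
    rw [h0, zero_re, zero_im, sub_zero] at h1
    rw [hz', sub_zero]
    refine h1.trans ?_
    have h3 : (γ u).re ≤ 0 := by linarith [hu.1]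
    rw [sub_zero, abs_of_nonpos h3, abs_of_nonpos (by linarith)]
    gcongr
    linarith
  rcases hz with ⟨hz, hz'⟩ | ⟨u, hu, rfl⟩ <;> rcases hw with ⟨hw, hw'⟩ | ⟨v, hv, rfl⟩
  · rw [hz', hw']
    simp
    positivity
  · rw [abs_sub_comm, abs_sub_comm z.re]
    exact hmixed _ _ hz hz' v hv rfl
  · exact hmixed _ _ hw hw' u hu rfl
  · rcases le_total u v with h | h
    · rw [abs_sub_comm, abs_sub_comm (γ u).re]
      exact hcurve u hu v hv h
    · exact hcurve v hv u hu h

theorem exists_graph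
    (hd : ∀ u ∈ Icc 0 s, HasDerivWithinAt γ (γ' u) (Icc 0 s) u)
    (hε : ∀ u ∈ Icc 0 s, ‖γ' u + 1‖ ≤ ε) (hε1 : ε ≤ 2 / 5) (hs : 0 ≤ s) (h0 : γ 0 = 0) :
    ∃ φ : ℝ → ℝ, Continuous φ ∧ ∀ z, OnExtended γ s z → φ z.re = z.im := by
  classical
  have hε0 : 0 ≤ ε := (norm_nonneg _).trans (hε 0 ⟨le_rfl, hs⟩)
  let A : Set ℝ := {x | ∃ y : ℝ, OnExtended γ s ⟨x, y⟩}
  let φ₀ : ℝ → ℝ := fun x => if h : ∃ y : ℝ, OnExtended γ s ⟨x, y⟩ then h.choose else 0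
  have hφ₀ : ∀ x ∈ A, OnExtended γ s ⟨x, φ₀ x⟩ := by
    intro x hx
    have hx' : ∃ y : ℝ, OnExtended γ s ⟨x, y⟩ := hx
    simp only [φ₀, dif_pos hx']
    exact hx'.choose_spec
  have hlip : LipschitzOnWith (5 / 3 * ε).toNNReal φ₀ A := by
    refine LipschitzOnWith.of_dist_le_mul fun x hx y hy => ?_
    rw [Real.dist_eq, Real.dist_eq, Real.coe_toNNReal _ (by positivity)]
    exact (hφ₀ x hx).abs_im_sub_le hd hε hε1 hs h0 (hφ₀ y hy)
  obtain ⟨φ, hφ, heq⟩ := hlip.extend_real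
  refine ⟨φ, hφ.continuous, fun z hz => ?_⟩
  have hzA : z.re ∈ A := ⟨z.im, hz⟩
  have h1 := (hφ₀ _ hzA).abs_im_sub_le hd hε hε1 hs h0 hz
  simp only [sub_self, abs_zero, mul_zero] at h1
  rw [← heq hzA]
  exact sub_eq_zero.1 (abs_eq_zero.1 (le_antisymm h1 (abs_nonneg _)))

theorem exists_onExtended
    (hd : ∀ u ∈ Icc 0 s, HasDerivWithinAt γ (γ' u) (Icc 0 s) u) (hs : 0 ≤ s) (h0 : γ 0 = 0)
    {X : ℝ} (hX : (γ s).re ≤ X) : ∃ y : ℝ, OnExtended γ s ⟨X, y⟩ := by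
  rcases le_total 0 X with h | h
  · exact ⟨0, Or.inl ⟨h, rfl⟩⟩
  have hc : ContinuousOn (fun u => (γ u).re) (Icc 0 s) :=
    Complex.continuous_re.comp_continuousOn fun u hu => (hd u hu).continuousWithinAt
  obtain ⟨u, hu, hu'⟩ := intermediate_value_Icc' hs hc ⟨hX, by simpa [h0] using h⟩
  exact ⟨(γ u).im, Or.inr ⟨u, hu, Complex.ext hu' rfl⟩⟩

theorem exists_isGraphHull
    (hd : ∀ u ∈ Icc 0 s, HasDerivWithinAt γ (γ' u) (Icc 0 s) u)
    (hε : ∀ u ∈ Icc 0 s, ‖γ' u + 1‖ ≤ ε) (hε1 : ε ≤ 2 / 5) (hs : 0 ≤ s) (h0 : γ 0 = 0)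
    {L : ℝ} (hL : 0 < L) (hsL : 7 / 5 * s ≤ L ^ 2) :
    ∃ φ X₀, IsGraphHull ((fun u => sqrtH (γ u)) '' Icc 0 s) φ X₀ (5 / 3 * ε) L (sqrtH (γ s)) := by
  obtain ⟨φ, hφ, hφe⟩ := exists_graph hd hε hε1 hs h0
  have hε0 : 0 ≤ ε := (norm_nonneg _).trans (hε 0 ⟨le_rfl, hs⟩)
  have h0s : (0 : ℝ) ∈ Icc 0 s := ⟨le_rfl, hs⟩
  have hss : s ∈ Icc 0 s := ⟨hs, le_rfl⟩
  have hre : ∀ u ∈ Icc 0 s, (γ u).re ≤ 0 := by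
    intro u hu
    have := le_re_sub hd hε hε1 h0s hu hu.1
    rw [h0, zero_re] at this
    linarith [hu.1]
  have hφγ : ∀ u ∈ Icc 0 s, φ (γ u).re = (γ u).im := fun u hu => hφe _ (Or.inr ⟨u, hu, rfl⟩)
  have hφ0 : ∀ X, 0 ≤ X → φ X = 0 := fun X hX => hφe ⟨X, 0⟩ (Or.inl ⟨hX, rfl⟩)
  refine ⟨φ, (γ s).re, ?_, hφ, hφ0, hre s hss, by positivity, ?_, ?_, ?_, hL, ?_,
    ⟨s, hss, rfl⟩, ?_⟩
  · exact isCompact_sqrtH_image (fun u hu => (hd u hu).continuousWithinAt)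
      fun u hu => Or.inl (hre u hu)
  · intro X hX
    obtain ⟨y, hy⟩ := exists_onExtended hd hs h0 hX
    have h1 := hy.abs_im_sub_le hd hε hε1 hs h0 (Or.inr ⟨s, hss, rfl⟩)
    rw [← hφe _ hy, ← hφγ s hss] at h1
    rwa [abs_of_nonneg (sub_nonneg.2 hX)] at h1
  · rintro _ ⟨u, hu, rfl⟩
    refine ⟨sqrtH_im_nonneg _, ?_⟩
    simp only [sqrtH_sq]
    refine ⟨?_, (hφγ u hu).symm⟩
    have := le_re_sub hd hε hε1 hu hss hu.2
    linarith [hu.2]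
  · intro z hz hz1 hz2
    obtain ⟨y, hy⟩ := exists_onExtended hd hs h0 hz1
    have h1 := hφe _ hy
    simp only at h1
    rw [← hz2] at h1
    subst h1
    rcases hy with ⟨h1, h2⟩ | ⟨u, hu, h1⟩
    · simp only at h1 h2
      have h3 : 0 < z.im := hz
      rw [sq_im'] at h2
      rw [sq_re'] at h1
      have h4 : z.re = 0 := by
        rcases mul_eq_zero.1 h2 with h | h
        · linarith
        · linarith
      rw [h4] at h1
      nlinarith
    · exact ⟨u, hu, (eq_sqrtH_of_mem_UHP hz h1.symm).symm⟩
  · rintro _ ⟨u, hu, rfl⟩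
    refine le_of_sq_le_sq ?_ hL.le
    rw [norm_sqrtH_sq]
    have h1 := norm_sub_add_le hd hε h0s hu
    rw [h0, sub_zero, sub_zero, abs_of_nonneg hu.1] at h1
    have h2 := norm_sub_le (γ u + (u : ℝ)) (u : ℝ)
    rw [add_sub_cancel_right, norm_real, Real.norm_eq_abs, abs_of_nonneg hu.1] at h2
    nlinarith [hu.1, hu.2]
  · rw [sqrtH_sq, hφγ s hss]

theorem re_le_of_norm_add_one_le
    (hd : ∀ u ∈ Icc 0 s, HasDerivWithinAt γ (γ' u) (Icc 0 s) u) (h1 : ∀ u ∈ Icc 0 s, ‖γ' u‖ = 1)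
    (hε : ∀ u ∈ Icc 0 s, ‖γ' u + 1‖ ≤ 2 / 5) (hs : 0 ≤ s) (h0 : γ 0 = 0) :
    (γ s).re ≤ -(23 / 25) * s := by
  have hre : ∀ u ∈ Icc 0 s, (γ' u).re ≤ -(23 / 25) := by
    intro u hu
    have e1 : ‖γ' u + 1‖ ^ 2 ≤ (2 / 5) ^ 2 := pow_le_pow_left₀ (norm_nonneg _) (hε u hu) 2
    have e2 : ‖γ' u‖ ^ 2 = 1 := by rw [h1 u hu, one_pow]
    rw [Complex.sq_norm, normSq_apply] at e1 e2
    simp only [add_re, one_re, add_im, one_im, add_zero] at e1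
    linarith
  have hd' : ∀ u ∈ Icc 0 s, HasDerivWithinAt (fun u => (γ u).re) (γ' u).re (Icc 0 s) u :=
    fun u hu => Complex.reCLM.hasFDerivAt.comp_hasDerivWithinAt u (hd u hu)
  refine image_le_of_deriv_right_le_deriv_boundary (B := fun u => -(23 / 25) * u)
    (B' := fun _ => -(23 / 25)) (fun u hu => (hd' u hu).continuousWithinAt)
    (fun u hu => (hd' u ⟨hu.1, hu.2.le⟩).mono_of_mem_nhdsWithin (Icc_mem_nhdsGE_of_mem hu))
    (by simp [h0]) (by fun_prop) (fun u _ => ?_) (fun u hu => hre u ⟨hu.1, hu.2.le⟩) ⟨hs, le_rfl⟩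
  simpa using ((hasDerivAt_id u).const_mul (-(23 / 25) : ℝ)).hasDerivWithinAt

end

/-- There is a universal constant `c > 0` such that for any
`R`-regular arclength-parametrized `C^1` simple curve `γ` tangentially attached
to `ℝ₊` with `ω(R) ≤ 1/5`, the driving function `W` of `η = √γ` satisfies
`|W_t| ≤ c·ω(5t)·t^{1/2}` for all `t ≤ R/5`; in particular if `γ ∈ C^{1,β}`
(i.e. `ω(δ) ≤ M·δ^β`) then `|W_t| ≤ C·t^{β+1/2}` for some constant `C`. -/
theorem initial_driving_bound :
    ∃ c : ℝ, 0 < c ∧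
      ∀ (S R : ℝ) (γ γ' : ℝ → ℂ) (ω t W : ℝ → ℝ),
        0 < S → 0 < R → R ≤ S →
        (∀ a b : ℝ, 0 ≤ a → a ≤ b → ω a ≤ ω b) →
        (∀ s ∈ Set.Icc (0:ℝ) S, HasDerivWithinAt γ (γ' s) (Set.Icc 0 S) s) →
        (∀ s ∈ Set.Icc (0:ℝ) S, ‖γ' s‖ = 1) →
        (∀ s ∈ Set.Icc (0:ℝ) S, ∀ s' ∈ Set.Icc (0:ℝ) S,
          ‖γ' s - γ' s'‖ ≤ ω |s - s'|) →
        γ 0 = 0 → γ' 0 = -1 →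
        Set.InjOn γ (Set.Icc 0 S) →
        (∀ s ∈ Set.Ioc (0:ℝ) S, ¬ (0 ≤ (γ s).re ∧ (γ s).im = 0)) →
        (∀ s ∈ Set.Icc (0:ℝ) S, ∀ r : ℝ, 0 < r → r ≤ R →
          IsConnected (Metric.closedBall (γ s) r ∩
            ((fun u : ℝ => if 0 ≤ u then γ u else ((-u : ℝ) : ℂ)) '' Set.Iic S))) →
        ω R ≤ 1/5 →
        (∀ s ∈ Set.Icc (0:ℝ) S,
          HasHCap ((fun u => sqrtH (γ u)) '' Set.Icc 0 s) (2 * t s)) →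
        (∀ s ∈ Set.Icc (0:ℝ) S, ∃ g : ℂ → ℂ,
          IsMappingOut ((fun u => sqrtH (γ u)) '' Set.Icc 0 s) g ∧
          Tendsto g (nhdsWithin (sqrtH (γ s))
            (UHP \ ((fun u => sqrtH (γ u)) '' Set.Icc 0 s)))
            (nhds ((W (t s) : ℝ) : ℂ))) →
        (∀ s ∈ Set.Icc (0:ℝ) S, t s ≤ R / 5 →
            |W (t s)| ≤ c * ω (5 * t s) * Real.sqrt (t s)) ∧
        (∀ β M : ℝ, 0 < β → β ≤ 1 → 0 ≤ M →
          (∀ δ : ℝ, 0 ≤ δ → ω δ ≤ M * δ ^ β) →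
          ∃ C : ℝ, 0 < C ∧ ∀ s ∈ Set.Icc (0:ℝ) S, t s ≤ R / 5 →
            |W (t s)| ≤ C * (t s) ^ (β + 1/2)) := by
  refine ⟨27, by norm_num, ?_⟩
  intro S R γ γ' ω t W hS hR hRS hω hd hnorm hmod h0 h0' _ havoid _ hωR hcap hdrive
  have h0S : (0 : ℝ) ∈ Icc 0 S := ⟨le_rfl, hS.le⟩
  have hω0 : ∀ a, 0 ≤ a → 0 ≤ ω a := by
    intro a ha
    have h1 := hmod 0 h0S 0 h0S
    simp only [sub_self, norm_zero, abs_zero] at h1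
    exact h1.trans (hω 0 a le_rfl ha)
  have htangent : ∀ v ∈ Icc 0 S, ‖γ' v + 1‖ ≤ 2 * ω (v / 2) := by
    intro v hv
    have hv2 : v / 2 ∈ Icc 0 S := ⟨by linarith [hv.1], by linarith [hv.1, hv.2]⟩
    have h1 := hmod v hv _ hv2
    have h2 := hmod _ hv2 0 h0S
    rw [h0', sub_zero, sub_neg_eq_add, abs_of_nonneg hv2.1] at h2
    rw [sub_half, abs_of_nonneg hv2.1] at h1
    have h3 := norm_add_le (γ' v - γ' (v / 2)) (γ' (v / 2) + 1)
    rw [show γ' v - γ' (v / 2) + (γ' (v / 2) + 1) = γ' v + 1 by ring] at h3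
    linarith
  have hd' : ∀ s ∈ Icc 0 S, ∀ u ∈ Icc 0 s, HasDerivWithinAt γ (γ' u) (Icc 0 s) u :=
    fun s hs u hu => (hd u ⟨hu.1, hu.2.trans hs.2⟩).mono (Icc_subset_Icc_right hs.2)
  have hcompact : ∀ s ∈ Icc 0 S, IsCompact ((fun u => sqrtH (γ u)) '' Icc 0 s) := by
    intro s hs
    refine isCompact_sqrtH_image (fun u hu => (hd' s hs u hu).continuousWithinAt) fun u hu => ?_
    rcases hu.1.eq_or_lt with rfl | hu0
    · left; simp [h0]
    · by_contra! h
      exact havoid u ⟨hu0, hu.2.trans hs.2⟩ ⟨h.1.le, h.2⟩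
  have ht0 : ∀ s ∈ Icc 0 S, 0 ≤ t s := fun s hs => by linarith [(hcap s hs).nonneg (hcompact s hs)]
  have hst : ∀ s ∈ Icc 0 S, t s ≤ R / 5 → s < 2 * R ∧ 23 / 25 * s ≤ 8 * t s := by
    intro s hs hts
    have hu : min s (2 * R) ∈ Icc 0 s := ⟨le_min hs.1 (by linarith), min_le_left _ _⟩
    set u := min s (2 * R) with hudef
    have hu2 : u ≤ 2 * R := min_le_right _ _
    have huS : u ∈ Icc 0 S := ⟨hu.1, hu.2.trans hs.2⟩
    have h1 : (γ u).re ≤ -(23 / 25) * u := by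
      refine re_le_of_norm_add_one_le (hd' u huS) (fun v hv => hnorm v ⟨hv.1, hv.2.trans huS.2⟩)
        (fun v hv => (htangent v ⟨hv.1, hv.2.trans huS.2⟩).trans ?_) hu.1 h0
      have := hω (v / 2) R (by linarith [hv.1]) (by linarith [hv.2])
      linarith
    have h2 := (hcap s hs).im_sq_le (hcompact s hs) ⟨u, hu, rfl⟩ (sqrtH_im_nonneg _)
    have h3 := neg_re_le_sqrtH_im_sq (γ u)
    have h4 : 23 / 25 * u ≤ 8 * t s := by simp only at h2; linarith
    rcases min_choice s (2 * R) with h | h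
    · rw [← hudef] at h
      rw [h] at h4
      exact ⟨by linarith, h4⟩
    · rw [← hudef] at h
      linarith
  have hmain : ∀ s ∈ Icc 0 S, t s ≤ R / 5 → |W (t s)| ≤ 27 * ω (5 * t s) * Real.sqrt (t s) := by
    intro s hs hts
    obtain ⟨hs2, hs3⟩ := hst s hs hts
    have hωt := hω0 (5 * t s) (by linarith [ht0 s hs])
    have hε : ∀ u ∈ Icc 0 s, ‖γ' u + 1‖ ≤ 2 * ω (s / 2) := by
      intro u hu
      refine (htangent u ⟨hu.1, hu.2.trans hs.2⟩).trans ?_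
      have := hω (u / 2) (s / 2) (by linarith [hu.1]) (by linarith [hu.2])
      linarith
    have hωs := hω (s / 2) R (by linarith [hs.1]) (by linarith)
    have hωs' := hω (s / 2) (5 * t s) (by linarith [hs.1]) (by linarith [ht0 s hs])
    have hsq := Real.sq_sqrt (ht0 s hs)
    have hsq0 := Real.sqrt_nonneg (t s)
    have hL : ∀ e > 0, |W (t s)| ≤ 20 / 3 * ω (5 * t s) * (4 * Real.sqrt (t s) + e) := by
      intro e he
      obtain ⟨g, hg, hgW⟩ := hdrive s hs
      obtain ⟨φ, X₀, hK⟩ := exists_isGraphHull (hd' s hs) hε (by linarith) hs.1 h0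
        (L := 4 * Real.sqrt (t s) + e) (by positivity) (by nlinarith [ht0 s hs])
      have := hK.abs_le hg hgW
      refine this.trans ?_
      have h5 : 0 ≤ 4 * Real.sqrt (t s) + e := by positivity
      refine mul_le_mul_of_nonneg_right ?_ h5
      linarith
    have hlim : Tendsto (fun e : ℝ => 20 / 3 * ω (5 * t s) * (4 * Real.sqrt (t s) + e)) (𝓝[>] 0)
        (𝓝 (20 / 3 * ω (5 * t s) * (4 * Real.sqrt (t s) + 0))) :=
      Tendsto.mono_left (Continuous.tendsto (by fun_prop) 0) nhdsWithin_le_nhds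
    have h6 := ge_of_tendsto hlim (by filter_upwards [self_mem_nhdsWithin] with e he using hL e he)
    nlinarith [mul_nonneg hωt hsq0]
  refine ⟨hmain, fun β M hβ _ hM hωβ => ⟨27 * M * 5 ^ β + 1, by positivity, fun s hs hts => ?_⟩⟩
  have h1 := hmain s hs hts
  have h2 := ht0 s hs
  have h3 := hωβ (5 * t s) (by positivity)
  rw [Real.mul_rpow (by norm_num) h2] at h3
  have h4 : t s ^ (β + 1 / 2) = t s ^ β * Real.sqrt (t s) := by
    rw [Real.rpow_add_of_nonneg h2 hβ.le (by norm_num), Real.sqrt_eq_rpow]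
  have h5 : 0 ≤ t s ^ β := Real.rpow_nonneg h2 _
  have h6 := Real.sqrt_nonneg (t s)
  rw [h4]
  calc _ ≤ _ := h1
    _ ≤ 27 * (M * (5 ^ β * t s ^ β)) * Real.sqrt (t s) := by gcongr
    _ ≤ 27 * (M * (5 ^ β * t s ^ β)) * Real.sqrt (t s) + t s ^ β * Real.sqrt (t s) := by
      have := mul_nonneg h5 h6
      linarith
    _ = _ := by ring
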